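/- arXiv:1208.2635 — 2 statements merged into one kernel-verified Lean document; each statement's English description precedes it below -/
import Mathlib

section
/- Fix ε > 0 and c ≥ 1, assume Condition I((2+ε)s⋆) holds, take λ = ((1+ε)/ε)·(23 + 5c)·log p, and assume min_{j ∈ J⋆} |β⋆_j| ≥ 3σ·√(λ/n)/ν_{(2+ε)s⋆}. Then with probability at least 1 − 7p^(−c) over the Gaussian noise z, any maximizer Ĵ_map of Π satisfies ‖β̂_{Ĵ_map} − β⋆‖_∞ ≤ σ·√(2(c+1)·log p/(n·ν_{s⋆}²)). -/
open MeasureTheory ProbabilityTheory Finset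
open scoped Classical ENNReal

/-- The Laplace transform of a centred product Gaussian vector. -/
lemma lintegral_exp_sum_mul_pi_gaussianReal {κ : Type*} [Fintype κ] (v : NNReal) (u : κ → ℝ) :
    ∫⁻ z, ENNReal.ofReal (Real.exp (∑ i, u i * z i)) ∂(Measure.pi fun _ : κ => gaussianReal 0 v)
      = ENNReal.ofReal (Real.exp (v * (∑ i, u i ^ 2) / 2)) := by
  have hint : ∀ i, Integrable (fun x : ℝ => Real.exp (u i * x)) (gaussianReal 0 v) :=
    fun i => integrable_exp_mul_gaussianReal (u i)
  simp_rw [Real.exp_sum]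
  rw [← ofReal_integral_eq_lintegral_ofReal
      (Integrable.fintype_prod (f := fun i x => Real.exp (u i * x)) hint)
      (ae_of_all _ fun z => Finset.prod_nonneg fun i _ => (Real.exp_pos _).le),
    integral_fintype_prod_eq_prod (f := fun i x => Real.exp (u i * x))]
  congr 1
  have h : ∀ i, ∫ x, Real.exp (u i * x) ∂(gaussianReal 0 v) = Real.exp (v * u i ^ 2 / 2) := by
    intro i
    have := mgf_gaussianReal (p := gaussianReal 0 v) (X := id) (Measure.map_id) (u i)
    simpa [mgf] using this
  simp_rw [h, ← Real.exp_sum, Finset.mul_sum, Finset.sum_div]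

lemma lintegral_exp_sq_div_four_gaussianReal :
    ∫⁻ x, ENNReal.ofReal (Real.exp (x ^ 2 / 4)) ∂(gaussianReal 0 1)
      = ENNReal.ofReal (Real.sqrt 2) := by
  rw [gaussianReal_of_var_ne_zero 0 one_ne_zero,
    lintegral_withDensity_eq_lintegral_mul _ (measurable_gaussianPDF 0 1) (by fun_prop)]
  have h : ∀ x : ℝ, (gaussianPDF 0 1 * fun x => ENNReal.ofReal (Real.exp (x ^ 2 / 4))) x
      = ENNReal.ofReal (Real.sqrt 2) * gaussianPDF 0 2 x := by
    intro x
    simp only [Pi.mul_apply, gaussianPDF, gaussianPDFReal]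
    rw [← ENNReal.ofReal_mul (by positivity), ← ENNReal.ofReal_mul (by positivity)]
    congr 1
    rw [mul_assoc, ← Real.exp_add]
    have h2 : Real.sqrt (2 * Real.pi * (2 : NNReal)) = Real.sqrt (2 * Real.pi) * Real.sqrt 2 := by
      rw [← Real.sqrt_mul (by positivity)]; simp
    rw [h2]
    have h3 : Real.sqrt 2 ≠ 0 := by positivity
    have h4 : Real.sqrt (2 * Real.pi) ≠ 0 := by positivity
    simp only [NNReal.coe_one, mul_one, NNReal.coe_ofNat, sub_zero]
    field_simp
    ring_nf
  simp_rw [h]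
  rw [lintegral_const_mul _ (measurable_gaussianPDF 0 2),
    lintegral_gaussianPDF_eq_one 0 two_ne_zero, mul_one]

lemma lintegral_exp_sum_sq_div_four_pi_gaussianReal {κ : Type*} [Fintype κ] :
    ∫⁻ g, ENNReal.ofReal (Real.exp (∑ k, g k ^ 2 / 4))
        ∂(Measure.pi fun _ : κ => gaussianReal 0 1)
      = ENNReal.ofReal (Real.sqrt 2) ^ Fintype.card κ := by
  have h : ∀ g : κ → ℝ, ENNReal.ofReal (Real.exp (∑ k, g k ^ 2 / 4))
      = ∏ k, ENNReal.ofReal (Real.exp (g k ^ 2 / 4)) := by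
    intro g
    rw [Real.exp_sum, ENNReal.ofReal_prod_of_nonneg fun i _ => (Real.exp_pos _).le]
  simp_rw [h]
  have hind : iIndepFun (fun (k : κ) (g : κ → ℝ) => ENNReal.ofReal (Real.exp (g k ^ 2 / 4)))
      (Measure.pi fun _ : κ => gaussianReal 0 1) :=
    iIndepFun_pi (X := fun _ x => ENNReal.ofReal (Real.exp (x ^ 2 / 4)))
      fun _ => (by fun_prop : Measurable fun x : ℝ =>
        ENNReal.ofReal (Real.exp (x ^ 2 / 4))).aemeasurable
  rw [lintegral_prod_eq_prod_lintegral_of_indepFun Finset.univ _ hind fun k => by fun_prop]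
  have hk : ∀ k : κ, ∫⁻ g : κ → ℝ, ENNReal.ofReal (Real.exp (g k ^ 2 / 4))
      ∂(Measure.pi fun _ : κ => gaussianReal 0 1) = ENNReal.ofReal (Real.sqrt 2) := by
    intro k
    rw [← lintegral_exp_sq_div_four_gaussianReal]
    exact (measurePreserving_eval (fun _ : κ => gaussianReal 0 1) k).lintegral_comp
      (f := fun x => ENNReal.ofReal (Real.exp (x ^ 2 / 4))) (by fun_prop)
  simp [hk]

/-- The exponential moment of the squared norm of the projection of a Gaussian vector onto the span
of an orthonormal family. -/
lemma lintegral_exp_sum_sq_inner_pi_gaussianReal {ι κ : Type*} [Fintype ι] [Fintype κ] {σ : ℝ}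
    (hσ : 0 < σ) {e : κ → EuclideanSpace ℝ ι} (he : Orthonormal ℝ e) :
    ∫⁻ z, ENNReal.ofReal (Real.exp ((∑ k, inner ℝ (e k) (WithLp.toLp 2 z) ^ 2) / (4 * σ ^ 2)))
        ∂(Measure.pi fun _ : ι => gaussianReal 0 (Real.toNNReal (σ ^ 2)))
      = ENNReal.ofReal (Real.sqrt 2) ^ Fintype.card κ := by
  have hs : (Real.sqrt 2) ^ 2 = 2 := Real.sq_sqrt (by norm_num)
  have h1 : ∀ z : ι → ℝ,
      ENNReal.ofReal (Real.exp ((∑ k, inner ℝ (e k) (WithLp.toLp 2 z) ^ 2) / (4 * σ ^ 2)))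
      = ∫⁻ g, ENNReal.ofReal (Real.exp
          (∑ k, inner ℝ (e k) (WithLp.toLp 2 z) / (Real.sqrt 2 * σ) * g k))
        ∂(Measure.pi fun _ : κ => gaussianReal 0 1) := by
    intro z
    rw [lintegral_exp_sum_mul_pi_gaussianReal]
    congr 2
    simp_rw [div_pow, mul_pow, hs, ← Finset.sum_div]
    simp only [NNReal.coe_one, one_mul]
    rw [div_div]
    ring_nf
  have h2 : ∀ g : κ → ℝ, ∫⁻ z : ι → ℝ, ENNReal.ofReal (Real.exp
          (∑ k, inner ℝ (e k) (WithLp.toLp 2 z) / (Real.sqrt 2 * σ) * g k))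
        ∂(Measure.pi fun _ : ι => gaussianReal 0 (Real.toNNReal (σ ^ 2)))
      = ENNReal.ofReal (Real.exp (∑ k, g k ^ 2 / 4)) := by
    intro g
    set w : EuclideanSpace ℝ ι := ∑ k, (g k / (Real.sqrt 2 * σ)) • e k with hw
    have hz : ∀ z : ι → ℝ, ∑ k, inner ℝ (e k) (WithLp.toLp 2 z) / (Real.sqrt 2 * σ) * g k
        = ∑ i, w i * z i := by
      intro z
      have : inner ℝ w (WithLp.toLp 2 z) = ∑ i, w i * z i := by
        simp [PiLp.inner_apply, mul_comm]
      rw [← this, hw, sum_inner]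
      refine Finset.sum_congr rfl fun k _ => ?_
      rw [real_inner_smul_left]
      ring
    simp_rw [hz]
    rw [lintegral_exp_sum_mul_pi_gaussianReal]
    congr 2
    have hn : ∑ i, w i ^ 2 = ∑ k, (g k / (Real.sqrt 2 * σ)) ^ 2 := by
      rw [← EuclideanSpace.real_norm_sq_eq, ← real_inner_self_eq_norm_sq, hw, he.inner_sum]
      simp [sq]
    rw [hn, Real.coe_toNNReal _ (sq_nonneg σ)]
    simp_rw [div_pow, mul_pow, hs, ← Finset.sum_div]
    field_simp
    norm_num
  rw [lintegral_congr h1]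
  rw [lintegral_lintegral_swap]
  · rw [lintegral_congr h2]
    exact lintegral_exp_sum_sq_div_four_pi_gaussianReal
  · refine Measurable.aemeasurable ?_
    fun_prop

/-- Markov's inequality for an exponential. -/
lemma meas_lt_le_of_lintegral_exp_le {α : Type*} [MeasurableSpace α] {ν : Measure α} {f : α → ℝ}
    (hf : Measurable f) {A : ℝ}
    (hA : ∫⁻ x, ENNReal.ofReal (Real.exp (f x)) ∂ν ≤ ENNReal.ofReal A) (t : ℝ) :
    ν {x | t < f x} ≤ ENNReal.ofReal (A * Real.exp (-t)) := by
  have h := mul_meas_ge_le_lintegral (μ := ν)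
    (f := fun x => ENNReal.ofReal (Real.exp (f x))) (by fun_prop) (ENNReal.ofReal (Real.exp t))
  have h0 : ENNReal.ofReal (Real.exp t) ≠ 0 := by
    simpa using Real.exp_pos t
  have hsub : {x | t < f x} ⊆
      {x | ENNReal.ofReal (Real.exp t) ≤ ENNReal.ofReal (Real.exp (f x))} := fun x hx =>
    ENNReal.ofReal_le_ofReal (Real.exp_le_exp.2 (le_of_lt hx))
  have h2 := (ENNReal.mul_le_iff_le_inv h0 ENNReal.ofReal_ne_top).1 (h.trans hA)
  refine (measure_mono hsub).trans (h2.trans (le_of_eq ?_))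
  rw [← ENNReal.ofReal_inv_of_pos (Real.exp_pos t), ← ENNReal.ofReal_mul (by positivity),
    ← Real.exp_neg, mul_comm]

/-- One-sided Gaussian tail bound for a linear form. -/
lemma meas_inner_pi_gaussianReal_lt_le {ι : Type*} [Fintype ι] {σ : ℝ} (hσ : 0 < σ)
    (v : EuclideanSpace ℝ ι) {t : ℝ} (ht : 0 ≤ t) :
    (Measure.pi fun _ : ι => gaussianReal 0 (Real.toNNReal (σ ^ 2)))
        {z | inner ℝ v (WithLp.toLp 2 z) < -(σ * ‖v‖ * t)}
      ≤ ENNReal.ofReal (Real.exp (-(t ^ 2 / 2))) := by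
  rcases eq_or_ne v 0 with rfl | hv
  · simp
  have hv' : 0 < ‖v‖ := norm_pos_iff.2 hv
  have hm := meas_lt_le_of_lintegral_exp_le
    (ν := Measure.pi fun _ : ι => gaussianReal 0 (Real.toNNReal (σ ^ 2)))
    (f := fun z => ∑ i, (-(t / (σ * ‖v‖)) * v i) * z i) (by fun_prop)
    (lintegral_exp_sum_mul_pi_gaussianReal _ _).le (t ^ 2)
  have hz : ∀ z : ι → ℝ, ∑ i, (-(t / (σ * ‖v‖)) * v i) * z i
      = -(t / (σ * ‖v‖)) * inner ℝ v (WithLp.toLp 2 z) := by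
    intro z
    simp only [PiLp.inner_apply, Finset.mul_sum]
    refine Finset.sum_congr rfl fun i _ => ?_
    simp
    ring
  have hn : ∑ i, (-(t / (σ * ‖v‖)) * v i) ^ 2 = t ^ 2 / σ ^ 2 := by
    simp_rw [mul_pow, ← Finset.mul_sum, ← EuclideanSpace.real_norm_sq_eq]
    field_simp
  rw [hn, Real.coe_toNNReal _ (sq_nonneg σ), ← Real.exp_add] at hm
  rcases ht.eq_or_lt with rfl | ht
  · refine (prob_le_one).trans ?_
    simp
  refine (measure_mono fun z hz' => ?_).trans (hm.trans (le_of_eq ?_))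
  · simp only [Set.mem_ofPred_eq, hz] at hz' ⊢
    have := mul_lt_mul_of_pos_left hz' (show 0 < t / (σ * ‖v‖) by positivity)
    have h2 : t / (σ * ‖v‖) * -(σ * ‖v‖ * t) = - t ^ 2 := by field_simp
    linarith
  · congr 2
    field_simp
    ring

/-- Chi-square tail bound for the projection of a Gaussian vector onto a subspace. -/
lemma meas_lt_norm_sq_starProjection_le {ι : Type*} [Fintype ι] {σ : ℝ} (hσ : 0 < σ)
    (W : Submodule ℝ (EuclideanSpace ℝ ι)) {m : ℕ} (hm : Module.finrank ℝ W ≤ m) (t : ℝ) :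
    (Measure.pi fun _ : ι => gaussianReal 0 (Real.toNNReal (σ ^ 2)))
        {z | σ ^ 2 * t < ‖W.starProjection (WithLp.toLp 2 z)‖ ^ 2}
      ≤ ENNReal.ofReal (Real.sqrt 2 ^ m * Real.exp (-(t / 4))) := by
  set b := stdOrthonormalBasis ℝ W
  have he : Orthonormal ℝ fun k => (b k : EuclideanSpace ℝ ι) :=
    b.orthonormal.comp_linearIsometry W.subtypeₗᵢ
  have hs : ∀ x : EuclideanSpace ℝ ι, ∑ k, inner ℝ (b k : EuclideanSpace ℝ ι) x ^ 2
      = ‖W.starProjection x‖ ^ 2 := by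
    intro x
    rw [Submodule.starProjection_apply]
    change _ = ‖W.orthogonalProjectionOnto x‖ ^ 2
    rw [← b.sum_sq_norm_inner_right (W.orthogonalProjectionOnto x)]
    refine Finset.sum_congr rfl fun k _ => ?_
    rw [← Submodule.inner_orthogonalProjectionOnto_eq_of_mem_left]
    simp
  have h := meas_lt_le_of_lintegral_exp_le
    (ν := Measure.pi fun _ : ι => gaussianReal 0 (Real.toNNReal (σ ^ 2)))
    (f := fun z => (∑ k, inner ℝ (b k : EuclideanSpace ℝ ι) (WithLp.toLp 2 z) ^ 2) / (4 * σ ^ 2))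
    (A := Real.sqrt 2 ^ m) (by fun_prop)
    (by
      rw [lintegral_exp_sum_sq_inner_pi_gaussianReal hσ he, ← ENNReal.ofReal_pow (by positivity)]
      refine ENNReal.ofReal_le_ofReal (pow_le_pow_right₀ ?_ (by simpa using hm))
      exact Real.one_le_sqrt.2 (by norm_num)) (t / 4)
  refine (measure_mono fun z hz => ?_).trans h
  simp only [Set.mem_ofPred_eq, hs] at hz ⊢
  rw [div_lt_div_iff₀ (by norm_num) (by positivity)]
  linarith
lemma sum_nonempty_pow_card_le {ι : Type*} [Fintype ι] {q : ℝ} (hq : 0 ≤ q)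
    (h : Fintype.card ι * q ≤ 1) :
    ∑ D : Finset ι with D.Nonempty, q ^ D.card ≤ 2 * (Fintype.card ι * q) := by
  have h1 : ∑ D : Finset ι, q ^ D.card = (q + 1) ^ Fintype.card ι := by
    simpa using Fintype.sum_pow_mul_eq_add_pow ι q 1
  have h2 : ∑ D : Finset ι, q ^ D.card = ∑ D : Finset ι with D.Nonempty, q ^ D.card + 1 := by
    rw [← Finset.sum_filter_add_sum_filter_not Finset.univ (fun D : Finset ι => D.Nonempty)]
    congr 1
    simp [Finset.not_nonempty_iff_eq_empty, Finset.filter_eq']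
  have h3 : (q + 1) ^ Fintype.card ι ≤ Real.exp (Fintype.card ι * q) := by
    rw [Real.exp_nat_mul]
    exact pow_le_pow_left₀ (by positivity) (Real.add_one_le_exp q) _
  have h0 : 0 ≤ Fintype.card ι * q := by positivity
  have h4 := Real.abs_exp_sub_one_le (x := Fintype.card ι * q) (by rwa [abs_of_nonneg h0])
  rw [abs_of_nonneg h0] at h4
  linarith [le_abs_self (Real.exp (Fintype.card ι * q) - 1)]

namespace Nat

lemma choose_add_le_choose_mul_pow (p k d : ℕ) : p.choose (k + d) ≤ p.choose k * p ^ d := by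
  induction d with
  | zero => simp
  | succ d ih =>
    calc p.choose (k + d + 1) ≤ p.choose (k + d + 1) * (k + d + 1) :=
          Nat.le_mul_of_pos_right _ (by omega)
      _ = p.choose (k + d) * (p - (k + d)) := Nat.choose_succ_right_eq p (k + d)
      _ ≤ p.choose k * p ^ d * p := Nat.mul_le_mul ih (Nat.sub_le _ _)
      _ = p.choose k * p ^ (d + 1) := by ring

lemma choose_le_choose_add_mul_pow {p k d : ℕ} (h : k + d ≤ p) :
    p.choose k ≤ p.choose (k + d) * p ^ d := by
  rw [← Nat.choose_symm (by omega : k ≤ p), ← Nat.choose_symm h]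
  have := choose_add_le_choose_mul_pow p (p - (k + d)) d
  rwa [show p - (k + d) + d = p - k by omega] at this

lemma choose_le_choose_mul_pow {p s k d : ℕ} (hp : 1 ≤ p) (hk : k ≤ p)
    (h1 : s ≤ k + d) (h2 : k ≤ s + d) : p.choose s ≤ p.choose k * p ^ d := by
  rcases le_total k s with h | h
  · obtain ⟨e, rfl⟩ := Nat.exists_eq_add_of_le h
    exact (choose_add_le_choose_mul_pow p k e).trans
      (Nat.mul_le_mul le_rfl (Nat.pow_le_pow_right hp (by omega)))
  · obtain ⟨e, rfl⟩ := Nat.exists_eq_add_of_le h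
    exact (choose_le_choose_add_mul_pow hk).trans
      (Nat.mul_le_mul le_rfl (Nat.pow_le_pow_right hp (by omega)))

end Nat

section Projection

variable {E : Type*} [NormedAddCommGroup E] [InnerProductSpace ℝ E] [FiniteDimensional ℝ E]

lemma norm_sub_starProjection_sq (A : Submodule ℝ E) (z : E) :
    ‖z - A.starProjection z‖ ^ 2 = ‖z‖ ^ 2 - ‖A.starProjection z‖ ^ 2 := by
  rw [A.norm_sq_eq_add_norm_sq_starProjection z, Submodule.starProjection_orthogonal_val]
  ring

lemma norm_sub_starProjection_le (A : Submodule ℝ E) (z : E) {w : E} (hw : w ∈ A) :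
    ‖z - A.starProjection z‖ ≤ ‖z - w‖ := by
  rw [Submodule.starProjection_minimal]
  exact ciInf_le ⟨0, by rintro _ ⟨v, rfl⟩; exact norm_nonneg _⟩ (⟨w, hw⟩ : A)

lemma norm_starProjection_sq_mono {A K : Submodule ℝ E} (h : A ≤ K) (z : E) :
    ‖A.starProjection z‖ ^ 2 ≤ ‖K.starProjection z‖ ^ 2 := by
  have h1 := norm_sub_starProjection_le K z (h (A.starProjection_apply_mem z))
  have h2 := pow_le_pow_left₀ (norm_nonneg _) h1 2
  rw [norm_sub_starProjection_sq, norm_sub_starProjection_sq] at h2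
  linarith

lemma norm_sq_sub_le_norm_add_sub_starProjection_sq {A K : Submodule ℝ E} (h : A ≤ K) {f : E}
    (hf : f ∈ K) (z : E) :
    ‖z‖ ^ 2 - ‖K.starProjection z‖ ^ 2 ≤ ‖f + z - A.starProjection (f + z)‖ ^ 2 := by
  rw [← norm_sub_starProjection_sq]
  have h1 := norm_sub_starProjection_le K z
    (K.sub_mem (h (A.starProjection_apply_mem (f + z))) hf)
  refine pow_le_pow_left₀ (norm_nonneg _) (h1.trans (le_of_eq ?_)) 2
  congr 1
  abel

lemma norm_add_sub_starProjection_sq (A : Submodule ℝ E) (f z : E) :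
    ‖f + z - A.starProjection (f + z)‖ ^ 2
      = ‖f - A.starProjection f‖ ^ 2 + 2 * inner ℝ (f - A.starProjection f) z
        + (‖z‖ ^ 2 - ‖A.starProjection z‖ ^ 2) := by
  have h : f + z - A.starProjection (f + z)
      = (f - A.starProjection f) + (z - A.starProjection z) := by
    rw [map_add]; abel
  rw [h, norm_add_sq_real, norm_sub_starProjection_sq A z, inner_sub_right,
    A.starProjection_inner_eq_zero f _ (A.starProjection_apply_mem z), sub_zero]

lemma norm_add_sub_starProjection_sq_of_mem {A : Submodule ℝ E} {f : E} (hf : f ∈ A) (z : E) :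
    ‖f + z - A.starProjection (f + z)‖ ^ 2 = ‖z‖ ^ 2 - ‖A.starProjection z‖ ^ 2 := by
  rw [norm_add_sub_starProjection_sq, Submodule.starProjection_eq_self_iff.2 hf]
  simp

lemma norm_starProjection_sq_sub {B K : Submodule ℝ E} (h : B ≤ K) (z : E) :
    ‖K.starProjection z‖ ^ 2 - ‖B.starProjection z‖ ^ 2
      = ‖(Bᗮ ⊓ K).starProjection z‖ ^ 2 := by
  have hB : ∀ w ∈ B, inner ℝ (K.starProjection z - B.starProjection z) w = 0 := by
    intro w hw
    have h1 := K.starProjection_inner_eq_zero z w (h hw)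
    have h2 := B.starProjection_inner_eq_zero z w hw
    rw [inner_sub_left] at h1 h2 ⊢
    linarith
  have he : (Bᗮ ⊓ K).starProjection z = K.starProjection z - B.starProjection z := by
    refine Submodule.eq_starProjection_of_mem_of_inner_eq_zero ⟨?_, ?_⟩ ?_
    · exact (Submodule.mem_orthogonal' _ _).2 hB
    · exact K.sub_mem (K.starProjection_apply_mem z) (h (B.starProjection_apply_mem z))
    · rintro w ⟨hw1, hw2⟩
      have h1 := K.starProjection_inner_eq_zero z w hw2
      have h2 := (Submodule.mem_orthogonal _ _).1 hw1 _ (B.starProjection_apply_mem z)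
      rw [inner_sub_left] at h1 ⊢
      rw [inner_sub_left]
      linarith
  have h3 : K.starProjection z = (K.starProjection z - B.starProjection z)
      + B.starProjection z := by abel
  rw [he]
  nth_rewrite 1 [h3]
  rw [norm_add_sq_real, hB _ (B.starProjection_apply_mem z)]
  ring

end Projection

section Columns

variable {ι E : Type*} [Fintype ι] [DecidableEq ι] [NormedAddCommGroup E] [InnerProductSpace ℝ E]
  [FiniteDimensional ℝ E] {x : ι → E}

omit [FiniteDimensional ℝ E] in
lemma sum_smul_mem_span_image {J : Finset ι} {u : ι → ℝ} (hu : ∀ j ∉ J, u j = 0) :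
    ∑ j, u j • x j ∈ Submodule.span ℝ (x '' J) := by
  refine Submodule.sum_mem _ fun j _ => ?_
  by_cases hj : j ∈ J
  · exact Submodule.smul_mem _ _ (Submodule.subset_span ⟨j, hj, rfl⟩)
  · simp [hu j hj]

omit [FiniteDimensional ℝ E] in
lemma exists_sum_smul_eq_of_mem_span_image {J : Finset ι} {v : E}
    (hv : v ∈ Submodule.span ℝ (x '' J)) :
    ∃ u : ι → ℝ, (∀ j ∉ J, u j = 0) ∧ ∑ j, u j • x j = v := by
  obtain ⟨u, hu⟩ := (Submodule.mem_span_image_finset_iff_exists_fun' ℝ).1 hv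
  refine ⟨fun j => if j ∈ J then u j else 0, fun j hj => by simp [hj], ?_⟩
  rw [← hu]
  simp [ite_smul, Finset.sum_ite_mem]

omit [Fintype ι] in
lemma finrank_orthogonal_inf_span_image_union_le (S D : Finset ι) :
    Module.finrank ℝ ((Submodule.span ℝ (x '' S))ᗮ ⊓
      Submodule.span ℝ (x '' (D ∪ S : Finset ι)) : Submodule ℝ E) ≤ D.card := by
  have hle : Submodule.span ℝ (x '' S) ≤ Submodule.span ℝ (x '' (D ∪ S : Finset ι)) :=
    Submodule.span_mono (Set.image_mono (by simp))
  have h1 := Submodule.finrank_add_inf_finrank_orthogonal hle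
  have h2 : Submodule.span ℝ (x '' (D ∪ S : Finset ι))
      = Submodule.span ℝ (x '' D) ⊔ Submodule.span ℝ (x '' S) := by
    rw [Finset.coe_union, Set.image_union, Submodule.span_union]
  have h3 := Submodule.finrank_add_le_finrank_add_finrank
    (Submodule.span ℝ (x '' D)) (Submodule.span ℝ (x '' S))
  have h4 : Module.finrank ℝ (Submodule.span ℝ (x '' D)) ≤ D.card := by
    rw [← Finset.coe_image]
    exact (finrank_span_finset_le_card _).trans Finset.card_image_le
  rw [← h2] at h3
  omega

/-- The distance from a sparse combination to a sub-model is bounded below by the missed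
coefficients. -/
lemma le_norm_sub_starProjection_sq {J S : Finset ι} {κ : ℝ}
    (hκ : ∀ u : ι → ℝ, (∀ j ∉ J ∪ S, u j = 0) → κ * ∑ j, u j ^ 2 ≤ ‖∑ j, u j • x j‖ ^ 2)
    (hκ0 : 0 ≤ κ) {β : ι → ℝ} (hβ : ∀ j ∉ S, β j = 0) :
    κ * ∑ j ∈ S \ J, β j ^ 2 ≤ ‖∑ j, β j • x j
      - (Submodule.span ℝ (x '' J)).starProjection (∑ j, β j • x j)‖ ^ 2 := by
  obtain ⟨u, hu, hu2⟩ := exists_sum_smul_eq_of_mem_span_image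
    ((Submodule.span ℝ (x '' J)).starProjection_apply_mem (∑ j, β j • x j))
  rw [← hu2, ← Finset.sum_sub_distrib]
  simp_rw [← sub_smul]
  refine le_trans ?_ (hκ (fun j => β j - u j) fun j hj => ?_)
  · refine mul_le_mul_of_nonneg_left ?_ hκ0
    calc ∑ j ∈ S \ J, β j ^ 2 = ∑ j ∈ S \ J, (β j - u j) ^ 2 :=
          Finset.sum_congr rfl fun j hj => by rw [hu j (Finset.mem_sdiff.1 hj).2, sub_zero]
      _ ≤ ∑ j, (β j - u j) ^ 2 :=
          Finset.sum_le_sum_of_subset_of_nonneg (Finset.subset_univ _) fun j _ _ => sq_nonneg _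
  · simp only [Finset.mem_union, not_or] at hj
    simp [hβ j hj.2, hu j hj.1]

variable (x) in
/-- The residual of the `j`-th vector after projection on the other vectors indexed by `S`. -/
noncomputable def columnResidual (S : Finset ι) (j : ι) : E :=
  x j - (Submodule.span ℝ (x '' (S.erase j))).starProjection (x j)

omit [Fintype ι] in
lemma columnResidual_mem {S : Finset ι} {j : ι} (hj : j ∈ S) :
    columnResidual x S j ∈ Submodule.span ℝ (x '' S) :=
  Submodule.sub_mem _ (Submodule.subset_span ⟨j, hj, rfl⟩)
    (Submodule.span_mono (Set.image_mono (by simp))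
      ((Submodule.span ℝ (x '' (S.erase j))).starProjection_apply_mem (x j)))

lemma inner_columnResidual_sum_smul {S : Finset ι} {j : ι} {θ : ι → ℝ}
    (hθ : ∀ k ∉ S, θ k = 0) :
    inner ℝ (columnResidual x S j) (∑ k, θ k • x k) = θ j * ‖columnResidual x S j‖ ^ 2 := by
  have hz : ∀ w ∈ Submodule.span ℝ (x '' (S.erase j)),
      inner ℝ (columnResidual x S j) w = 0 := fun w hw =>
    Submodule.starProjection_inner_eq_zero _ _ hw
  have hj : inner ℝ (columnResidual x S j) (x j) = ‖columnResidual x S j‖ ^ 2 := by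
    rw [← real_inner_self_eq_norm_sq]
    conv_rhs => rw [columnResidual, inner_sub_right]; rw [← columnResidual]
    rw [hz _ (Submodule.starProjection_apply_mem _ _), sub_zero]
  rw [inner_sum, Finset.sum_eq_single j]
  · rw [real_inner_smul_right, hj]
  · intro k _ hk
    by_cases hkS : k ∈ S
    · rw [real_inner_smul_right, hz _ (Submodule.subset_span
        ⟨k, Finset.mem_coe.2 (Finset.mem_erase.2 ⟨hk, hkS⟩), rfl⟩), mul_zero]
    · simp [hθ k hkS]
  · simp

lemma le_norm_columnResidual_sq {S : Finset ι} {j : ι} (hj : j ∈ S) {κ : ℝ} (hκ0 : 0 ≤ κ)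
    (hκ : ∀ u : ι → ℝ, (∀ k ∉ S, u k = 0) → κ * ∑ k, u k ^ 2 ≤ ‖∑ k, u k • x k‖ ^ 2) :
    κ ≤ ‖columnResidual x S j‖ ^ 2 := by
  have h := le_norm_sub_starProjection_sq (x := x) (J := S.erase j) (S := S) (κ := κ)
    (β := Pi.single j 1)
    (fun u hu => hκ u fun k hk => hu k (by simp [hk])) hκ0
    (fun k hk => Pi.single_eq_of_ne (by rintro rfl; exact hk hj) _)
  have h1 : ∑ k, (Pi.single j (1 : ℝ) : ι → ℝ) k • x k = x j := by
    rw [Finset.sum_eq_single j] <;> simp +contextual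
  have h2 : S \ S.erase j = {j} := by
    ext k; simp; grind
  rw [h1, h2] at h
  simpa [columnResidual] using h

end Columns

lemma sub_add_pos_of_large_card {σ lam L c ε R a b s k : ℝ} (hσ : 0 < σ) (hL : 0 < L) (hc : 1 ≤ c)
    (hε : 0 < ε) (hlam : lam = ((1 + ε) / ε) * (23 + 5 * c) * L) (hs : 0 < s) (has : a ≤ s)
    (hks : k + a = s + b) (hk : (1 + ε) * s < k)
    (hR : -(σ ^ 2 * ((6 + 4 * c) * b * L)) ≤ R) :
    0 < R + 2 * σ ^ 2 * (lam * (k - s)) - 2 * σ ^ 2 * ((a + b) * L) := by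
  have hsk : s ≤ k := by nlinarith
  have h1 : k ≤ (1 + ε) / ε * (k - s) := by
    rw [div_mul_eq_mul_div, le_div_iff₀ hε]; nlinarith
  have hcL : 0 < (23 + 5 * c) * L := by positivity
  have h2 : (23 + 5 * c) * L * k ≤ lam * (k - s) := by
    calc (23 + 5 * c) * L * k ≤ (23 + 5 * c) * L * ((1 + ε) / ε * (k - s)) :=
          mul_le_mul_of_nonneg_left h1 hcL.le
      _ = lam * (k - s) := by rw [hlam]; ring
  have h3 : (6 + 4 * c) * b * L ≤ (6 + 4 * c) * k * L := by gcongr; linarith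
  have h4 : (a + b) * L ≤ 2 * k * L := by gcongr; linarith
  have h5 : 0 < σ ^ 2 * (L * k * (36 + 6 * c)) := by
    have : 0 < k := by linarith
    positivity
  have h6 := mul_le_mul_of_nonneg_left h2 (sq_nonneg σ)
  have h7 := mul_le_mul_of_nonneg_left h3 (sq_nonneg σ)
  have h8 := mul_le_mul_of_nonneg_left h4 (sq_nonneg σ)
  linarith

lemma sub_add_pos_of_signal {σ lam L c R S ip a b s k : ℝ} (hσ : 0 < σ) (hL : 0 < L) (hc : 1 ≤ c)
    (hlam : (23 + 5 * c) * L ≤ lam) (ha : 0 ≤ a) (hb : 0 ≤ b) (hab : 0 < a + b)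
    (hks : k + a = s + b) (hS : 9 * σ ^ 2 * lam * a ≤ S ^ 2)
    (hip : -(σ * S * Real.sqrt (2 * (1 + c) * (a + b) * L)) ≤ ip)
    (hR : S ^ 2 + 2 * ip - σ ^ 2 * ((6 + 4 * c) * b * L) ≤ R) :
    0 < R + 2 * σ ^ 2 * (lam * (k - s)) - 2 * σ ^ 2 * ((a + b) * L) := by
  set t := Real.sqrt (2 * (1 + c) * (a + b) * L) with ht
  have ht2 : t ^ 2 = 2 * (1 + c) * (a + b) * L := Real.sq_sqrt (by positivity)
  have h1 : 2 * (σ * S * t) ≤ S ^ 2 / 2 + 2 * (σ ^ 2 * t ^ 2) := by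
    nlinarith [sq_nonneg (S - 2 * σ * t)]
  rw [ht2] at h1
  rw [show k - s = b - a by linarith]
  have h2 : σ ^ 2 * ((23 + 5 * c) * L * a) ≤ σ ^ 2 * (lam * a) := by gcongr
  have h3 : σ ^ 2 * ((23 + 5 * c) * L * b) ≤ σ ^ 2 * (lam * b) := by gcongr
  have h4 : 0 < σ ^ 2 * (L * (a + b)) := by positivity
  have h5 : 0 ≤ σ ^ 2 * (L * a * c) := by positivity
  have h6 : 0 ≤ σ ^ 2 * (L * b * c) := by positivity
  have h7 : 0 ≤ σ ^ 2 * (L * a) := by positivity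
  have h8 : 0 ≤ σ ^ 2 * (L * b) := by positivity
  linarith

lemma inv_mul_exp_mul_exp_lt {σ lam R R₀ p Cs Ck : ℝ} {d : ℕ} {s k : ℝ} (hσ : 0 < σ) (hp : 0 < p)
    (hCs : 0 < Cs) (hCk : 0 < Ck) (hC : Cs ≤ Ck * p ^ d)
    (h : 0 < R - R₀ + 2 * σ ^ 2 * (lam * (k - s)) - 2 * σ ^ 2 * (d * Real.log p)) :
    Ck⁻¹ * Real.exp (-(lam * k)) * Real.exp (-R / (2 * σ ^ 2))
      < Cs⁻¹ * Real.exp (-(lam * s)) * Real.exp (-R₀ / (2 * σ ^ 2)) := by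
  have h1 : Ck⁻¹ ≤ Cs⁻¹ * p ^ d := by
    rw [inv_mul_eq_div, le_div_iff₀ hCs, inv_mul_le_iff₀ hCk]
    exact hC
  have h2 : p ^ d = Real.exp (d * Real.log p) := by
    rw [Real.exp_nat_mul, Real.exp_log hp]
  rw [mul_assoc, mul_assoc, ← Real.exp_add, ← Real.exp_add]
  calc Ck⁻¹ * Real.exp (-(lam * k) + -R / (2 * σ ^ 2))
      ≤ Cs⁻¹ * p ^ d * Real.exp (-(lam * k) + -R / (2 * σ ^ 2)) := by gcongr
    _ = Cs⁻¹ * Real.exp (d * Real.log p + (-(lam * k) + -R / (2 * σ ^ 2))) := by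
        rw [h2, mul_assoc, ← Real.exp_add]
    _ < Cs⁻¹ * Real.exp (-(lam * s) + -R₀ / (2 * σ ^ 2)) := by
        refine mul_lt_mul_of_pos_left (Real.exp_lt_exp.2 ?_) (by positivity)
        have h3 : -(lam * s) + -R₀ / (2 * σ ^ 2)
            - (d * Real.log p + (-(lam * k) + -R / (2 * σ ^ 2)))
            = (R - R₀ + 2 * σ ^ 2 * (lam * (k - s)) - 2 * σ ^ 2 * (d * Real.log p))
              / (2 * σ ^ 2) := by
          field_simp
          ring
        have h4 := div_pos h (show 0 < 2 * σ ^ 2 by positivity)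
        linarith

section ModelComparison

variable {ι E : Type*} [Fintype ι] [DecidableEq ι] [NormedAddCommGroup E] [InnerProductSpace ℝ E]
  [FiniteDimensional ℝ E] {x : ι → E}

/-- On the event where the noise is controlled, the penalized residual of any model other than the
true one exceeds that of the true model. -/
lemma penalized_residual_gap_pos {σ lam L c ε κ : ℝ} (hσ : 0 < σ) (hL : 0 < L) (hc : 1 ≤ c)
    (hε : 0 < ε) (hlam : lam = ((1 + ε) / ε) * (23 + 5 * c) * L) (hκ0 : 0 < κ)
    {S J : Finset ι} (hS : S.Nonempty) (hJS : J ≠ S)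
    (hκ : ((J ∪ S).card : ℝ) ≤ (2 + ε) * S.card →
      ∀ u : ι → ℝ, (∀ j ∉ J ∪ S, u j = 0) → κ * ∑ j, u j ^ 2 ≤ ‖∑ j, u j • x j‖ ^ 2)
    {β : ι → ℝ} (hβ : ∀ j ∉ S, β j = 0)
    (hβmin : ∀ j ∈ S, 9 * σ ^ 2 * lam ≤ κ * β j ^ 2) {f z : E} (hf : f = ∑ j, β j • x j)
    (hip : -(σ * ‖f - (Submodule.span ℝ (x '' J)).starProjection f‖
        * Real.sqrt (2 * (1 + c) * (((S \ J).card : ℝ) + (J \ S).card) * L))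
      ≤ inner ℝ (f - (Submodule.span ℝ (x '' J)).starProjection f) z)
    (hchi : ‖((Submodule.span ℝ (x '' S))ᗮ ⊓
        Submodule.span ℝ (x '' ((J \ S) ∪ S : Finset ι))).starProjection z‖ ^ 2
      ≤ σ ^ 2 * ((6 + 4 * c) * (J \ S).card * L)) :
    0 < ‖f + z - (Submodule.span ℝ (x '' J)).starProjection (f + z)‖ ^ 2
        - ‖f + z - (Submodule.span ℝ (x '' S)).starProjection (f + z)‖ ^ 2
        + 2 * σ ^ 2 * (lam * ((J.card : ℝ) - S.card))
        - 2 * σ ^ 2 * ((((S \ J).card : ℝ) + (J \ S).card) * L) := by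
  have hSK : Submodule.span ℝ (x '' S) ≤ Submodule.span ℝ (x '' ((J \ S) ∪ S : Finset ι)) :=
    Submodule.span_mono (Set.image_mono (Finset.coe_subset.2 Finset.subset_union_right))
  have hJK : Submodule.span ℝ (x '' J) ≤ Submodule.span ℝ (x '' ((J \ S) ∪ S : Finset ι)) :=
    Submodule.span_mono (Set.image_mono (Finset.coe_subset.2
      (by rw [Finset.sdiff_union_self_eq_union]; exact Finset.subset_union_left)))
  have hfS : f ∈ Submodule.span ℝ (x '' S) := hf ▸ sum_smul_mem_span_image hβ
  rw [← norm_starProjection_sq_sub hSK] at hchi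
  have hcardN : J.card + (S \ J).card = S.card + (J \ S).card := by
    have h1 := Finset.card_sdiff_add_card J S
    have h2 := Finset.card_sdiff_add_card S J
    rw [Finset.union_comm] at h2
    omega
  have hcard : (J.card : ℝ) + (S \ J).card = S.card + (J \ S).card := by exact_mod_cast hcardN
  rw [norm_add_sub_starProjection_sq_of_mem hfS]
  by_cases hk : (1 + ε) * (S.card : ℝ) < J.card
  · refine sub_add_pos_of_large_card hσ hL hc hε hlam
      (Nat.cast_pos.2 hS.card_pos) (Nat.cast_le.2 (Finset.card_le_card Finset.sdiff_subset))
      hcard hk ?_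
    have := norm_sq_sub_le_norm_add_sub_starProjection_sq hJK (hSK hfS) z
    linarith
  · have hU : ((J ∪ S).card : ℝ) ≤ (2 + ε) * S.card := by
      have : ((J ∪ S).card : ℝ) ≤ J.card + S.card := by exact_mod_cast Finset.card_union_le J S
      linarith
    have hsig := le_norm_sub_starProjection_sq (hκ hU) hκ0.le hβ
    rw [← hf] at hsig
    have hpos : 0 < (S \ J).card + (J \ S).card := by
      by_contra h0
      have ha : S \ J = ∅ := Finset.card_eq_zero.1 (by omega)
      have hb : J \ S = ∅ := Finset.card_eq_zero.1 (by omega)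
      exact hJS (Finset.Subset.antisymm (Finset.sdiff_eq_empty_iff_subset.1 hb)
        (Finset.sdiff_eq_empty_iff_subset.1 ha))
    refine sub_add_pos_of_signal hσ hL hc ?_ (Nat.cast_nonneg _) (Nat.cast_nonneg _)
      (by exact_mod_cast hpos) hcard (le_trans ?_ hsig) hip ?_
    · rw [hlam, mul_assoc]
      refine le_mul_of_one_le_left (by positivity) ?_
      rw [one_le_div hε]
      linarith
    · rw [Finset.mul_sum]
      have := Finset.sum_le_sum fun j (hj : j ∈ S \ J) => hβmin j (Finset.mem_sdiff.1 hj).1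
      rw [Finset.sum_const, nsmul_eq_mul] at this
      linarith
    · rw [norm_add_sub_starProjection_sq]
      have := norm_starProjection_sq_mono hJK z
      linarith

/-- The coefficient error in the true model is controlled by the column residuals. -/
lemma abs_le_of_sum_smul_eq_starProjection {S : Finset ι} {σ t κ : ℝ} (hκ0 : 0 < κ)
    (hκ : ∀ u : ι → ℝ, (∀ k ∉ S, u k = 0) → κ * ∑ k, u k ^ 2 ≤ ‖∑ k, u k • x k‖ ^ 2)
    {θ : ι → ℝ} (hθ : ∀ k ∉ S, θ k = 0) {z : E}
    (hz : ∑ k, θ k • x k = (Submodule.span ℝ (x '' S)).starProjection z) {j : ι} (hj : j ∈ S)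
    (hr : |inner ℝ (columnResidual x S j) z| ≤ σ * ‖columnResidual x S j‖ * t) :
    |θ j| ≤ σ * (t / Real.sqrt κ) := by
  have h1 := inner_columnResidual_sum_smul (x := x) (j := j) hθ
  have h2 := le_norm_columnResidual_sq (x := x) hj hκ0.le hκ
  rw [hz, ← Submodule.inner_starProjection_left_eq_right,
    Submodule.starProjection_eq_self_iff.2 (columnResidual_mem hj)] at h1
  set r := ‖columnResidual x S j‖
  have hr0 : 0 ≤ r := norm_nonneg _
  have hκr : Real.sqrt κ ≤ r := Real.sqrt_le_iff.2 ⟨hr0, h2⟩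
  have hsκ : 0 < Real.sqrt κ := Real.sqrt_pos.2 hκ0
  have hrpos : 0 < r := hsκ.trans_le hκr
  rw [h1, abs_mul, abs_of_nonneg (sq_nonneg r)] at hr
  have h3 : |θ j| * r ≤ σ * t := by
    refine le_of_mul_le_mul_right ?_ hrpos
    linarith
  rw [← mul_div_assoc, le_div_iff₀ hsκ]
  exact (mul_le_mul_of_nonneg_left hκr (abs_nonneg _)).trans h3

end ModelComparison

section UnionBounds

/-- A union bound over nonempty index sets, with geometrically decaying probabilities. -/
lemma measure_iUnion_nonempty_le {ι Ω : Type*} [Fintype ι] [MeasurableSpace Ω] {ν : Measure Ω}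
    {q : ℝ} (hq : 0 ≤ q) (h : Fintype.card ι * q ≤ 1) {A : Finset ι → Set Ω}
    (hA : ∀ D : Finset ι, D.Nonempty → ν (A D) ≤ ENNReal.ofReal (q ^ D.card)) :
    ν (⋃ D ∈ Finset.univ.filter fun D : Finset ι => D.Nonempty, A D)
      ≤ ENNReal.ofReal (2 * (Fintype.card ι * q)) := by
  refine (measure_biUnion_finset_le _ _).trans ?_
  refine (Finset.sum_le_sum fun D hD => hA D (Finset.mem_filter.1 hD).2).trans ?_
  rw [← ENNReal.ofReal_sum_of_nonneg fun D _ => by positivity]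
  exact ENNReal.ofReal_le_ofReal (sum_nonempty_pow_card_le hq h)

/-- Uniform control of finitely many linear forms of a Gaussian vector. -/
lemma measure_iUnion_lt_abs_inner_le {ι κ : Type*} [Fintype ι] [Fintype κ] {σ t : ℝ} (hσ : 0 < σ)
    (ht : 0 ≤ t) (r : κ → EuclideanSpace ℝ ι) :
    (Measure.pi fun _ : ι => gaussianReal 0 (Real.toNNReal (σ ^ 2)))
        (⋃ j ∈ (Finset.univ : Finset κ),
          {z | σ * ‖r j‖ * t < |inner ℝ (r j) (WithLp.toLp 2 z)|})
      ≤ ENNReal.ofReal (2 * (Fintype.card κ * Real.exp (-(t ^ 2 / 2)))) := by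
  refine (measure_biUnion_finset_le _ _).trans ?_
  have h : ∀ j, (Measure.pi fun _ : ι => gaussianReal 0 (Real.toNNReal (σ ^ 2)))
      {z | σ * ‖r j‖ * t < |inner ℝ (r j) (WithLp.toLp 2 z)|}
        ≤ ENNReal.ofReal (2 * Real.exp (-(t ^ 2 / 2))) := by
    intro j
    have hsub : {z : ι → ℝ | σ * ‖r j‖ * t < |inner ℝ (r j) (WithLp.toLp 2 z)|}
        ⊆ {z | inner ℝ (r j) (WithLp.toLp 2 z) < -(σ * ‖r j‖ * t)}
          ∪ {z | inner ℝ (-r j) (WithLp.toLp 2 z) < -(σ * ‖-r j‖ * t)} := by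
      intro z hz
      rw [Set.mem_ofPred_eq] at hz
      rcases lt_abs.1 hz with hz | hz
      · right
        simp only [Set.mem_ofPred_eq, inner_neg_left, norm_neg]
        linarith
      · left
        simp only [Set.mem_ofPred_eq]
        linarith
    refine (measure_mono hsub).trans ((measure_union_le _ _).trans ?_)
    rw [two_mul, ENNReal.ofReal_add (by positivity) (by positivity)]
    exact add_le_add (meas_inner_pi_gaussianReal_lt_le hσ _ ht)
      (meas_inner_pi_gaussianReal_lt_le hσ _ ht)
  refine (Finset.sum_le_sum fun j _ => h j).trans (le_of_eq ?_)
  rw [Finset.sum_const, nsmul_eq_mul, Finset.card_univ, ← ENNReal.ofReal_natCast,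
    ← ENNReal.ofReal_mul (by positivity)]
  congr 1
  ring

end UnionBounds

lemma sqrt_two_pow_mul_exp_le {p m : ℕ} (hp : 2 ≤ p) (c : ℝ) :
    Real.sqrt 2 ^ m * Real.exp (-((6 + 4 * c) * m * Real.log p / 4))
      ≤ Real.exp (-((1 + c) * Real.log p)) ^ m := by
  have h2 : Real.sqrt 2 ≤ Real.exp (Real.log p / 2) := by
    have : Real.exp (Real.log p / 2) ^ 2 = p := by
      rw [← Real.exp_nat_mul, Nat.cast_ofNat, mul_div_cancel₀ _ two_ne_zero,
        Real.exp_log (by positivity)]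
    exact Real.sqrt_le_iff.2 ⟨(Real.exp_pos _).le, by rw [this]; exact_mod_cast hp⟩
  calc Real.sqrt 2 ^ m * Real.exp (-((6 + 4 * c) * m * Real.log p / 4))
      ≤ Real.exp (Real.log p / 2) ^ m * Real.exp (-((6 + 4 * c) * m * Real.log p / 4)) := by
        gcongr
    _ = Real.exp (-((1 + c) * Real.log p)) ^ m := by
        rw [← Real.exp_nat_mul, ← Real.exp_nat_mul, ← Real.exp_add]
        congr 1
        ring

section Design

variable {n p : ℕ} {X : Matrix (Fin n) (Fin p) ℝ}

lemma sum_smul_col_eq_toLp_mulVec (u : Fin p → ℝ) :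
    ∑ j, u j • (WithLp.toLp 2 fun i => X i j : EuclideanSpace ℝ (Fin n))
      = WithLp.toLp 2 (X.mulVec u) := by
  ext i
  simp [Matrix.mulVec, dotProduct, mul_comm]

lemma bddBelow_restricted_norms (s : ℝ) :
    BddBelow {r : ℝ | ∃ (J : Finset (Fin p)) (u : Fin p → ℝ),
        (J.card : ℝ) ≤ s ∧ (∀ j ∉ J, u j = 0) ∧ (∑ j, (u j)^2) = 1 ∧
        r = Real.sqrt (∑ i, (X.mulVec u i)^2) / Real.sqrt n} := by
  refine ⟨0, ?_⟩
  rintro r ⟨J, u, -, -, -, rfl⟩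
  positivity

/-- The restricted eigenvalue inequality, in homogeneous form. -/
lemma restricted_eigenvalue_le (hn : 1 ≤ n) {nu s : ℝ} (hnu0 : 0 ≤ nu)
    (hnu : nu = sInf {r : ℝ | ∃ (J : Finset (Fin p)) (u : Fin p → ℝ),
        (J.card : ℝ) ≤ s ∧ (∀ j ∉ J, u j = 0) ∧ (∑ j, (u j)^2) = 1 ∧
        r = Real.sqrt (∑ i, (X.mulVec u i)^2) / Real.sqrt n})
    {J : Finset (Fin p)} (hJ : (J.card : ℝ) ≤ s) {u : Fin p → ℝ} (hu : ∀ j ∉ J, u j = 0) :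
    n * nu ^ 2 * ∑ j, u j ^ 2
      ≤ ‖∑ j, u j • (WithLp.toLp 2 fun i => X i j : EuclideanSpace ℝ (Fin n))‖ ^ 2 := by
  rw [sum_smul_col_eq_toLp_mulVec, EuclideanSpace.real_norm_sq_eq]
  have hT0 : 0 ≤ ∑ j, u j ^ 2 := Finset.sum_nonneg fun _ _ => sq_nonneg _
  rcases hT0.eq_or_lt with h0 | hT
  · rw [← h0, mul_zero]
    exact Finset.sum_nonneg fun _ _ => sq_nonneg _
  set T := ∑ j, u j ^ 2 with hTdef
  have hsT : Real.sqrt T ^ 2 = T := Real.sq_sqrt hT0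
  have hn' : (0 : ℝ) < n := by exact_mod_cast hn
  have hle : nu ≤ Real.sqrt (∑ i, (X.mulVec ((Real.sqrt T)⁻¹ • u) i) ^ 2) / Real.sqrt n := by
    rw [hnu]
    refine csInf_le (bddBelow_restricted_norms s) ⟨J, (Real.sqrt T)⁻¹ • u, hJ, ?_, ?_, rfl⟩
    · intro j hj
      simp [hu j hj]
    · simp only [Pi.smul_apply, smul_eq_mul, mul_pow, inv_pow, hsT, ← Finset.mul_sum]
      exact inv_mul_cancel₀ hT.ne'
  have h2 := pow_le_pow_left₀ hnu0 hle 2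
  rw [div_pow, Real.sq_sqrt (Finset.sum_nonneg fun _ _ => sq_nonneg _), Real.sq_sqrt hn'.le,
    Matrix.mulVec_smul] at h2
  simp only [Pi.smul_apply, smul_eq_mul, mul_pow, inv_pow, hsT, ← Finset.mul_sum] at h2
  rw [le_div_iff₀ hn', ← div_eq_inv_mul, le_div_iff₀ hT] at h2
  linarith

lemma restricted_eigenvalue_anti [NeZero p] {s s' : ℝ} (hs : 1 ≤ s) (hss : s ≤ s') :
    sInf {r : ℝ | ∃ (J : Finset (Fin p)) (u : Fin p → ℝ),
        (J.card : ℝ) ≤ s' ∧ (∀ j ∉ J, u j = 0) ∧ (∑ j, (u j)^2) = 1 ∧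
        r = Real.sqrt (∑ i, (X.mulVec u i)^2) / Real.sqrt n}
    ≤ sInf {r : ℝ | ∃ (J : Finset (Fin p)) (u : Fin p → ℝ),
        (J.card : ℝ) ≤ s ∧ (∀ j ∉ J, u j = 0) ∧ (∑ j, (u j)^2) = 1 ∧
        r = Real.sqrt (∑ i, (X.mulVec u i)^2) / Real.sqrt n} := by
  refine csInf_le_csInf (bddBelow_restricted_norms s') ?_ ?_
  · refine ⟨_, {0}, Pi.single 0 1, by simpa using hs, fun j hj => ?_, ?_, rfl⟩
    · exact Pi.single_eq_of_ne (by simpa using hj) _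
    · simp [Pi.single_apply]
  · rintro r ⟨J, u, hJ, h⟩
    exact ⟨J, u, hJ.trans hss, h⟩

lemma toLp_eq_starProjection {J : Finset (Fin p)} {v w : Fin n → ℝ}
    (h : (∃ cf : Fin p → ℝ, (∀ j ∉ J, cf j = 0) ∧ w = X.mulVec cf)
        ∧ ∀ j ∈ J, (∑ i, (v i - w i) * X i j) = 0) :
    (WithLp.toLp 2 w : EuclideanSpace ℝ (Fin n))
      = (Submodule.span ℝ ((fun j => (WithLp.toLp 2 fun i => X i j : EuclideanSpace ℝ (Fin n)))
          '' J)).starProjection (WithLp.toLp 2 v) := by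
  obtain ⟨⟨cf, hcf, rfl⟩, h⟩ := h
  refine (Submodule.eq_starProjection_of_mem_orthogonal ?_ ?_).symm
  · rw [← sum_smul_col_eq_toLp_mulVec]
    exact sum_smul_mem_span_image hcf
  · rw [Submodule.mem_orthogonal]
    intro u hu
    induction hu using Submodule.span_induction with
    | mem u hu =>
      obtain ⟨j, hj, rfl⟩ := hu
      have := h j hj
      simpa [PiLp.inner_apply] using this
    | zero => simp
    | add u u' _ _ h1 h2 => rw [inner_add_left, h1, h2, add_zero]
    | smul a u _ h1 => rw [inner_smul_left, h1, mul_zero]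

end Design

section NoiseEvent

variable {ι κ : Type*} [Fintype ι] [Fintype κ] [DecidableEq κ]

/-- The event on which the noise is controlled uniformly over all sub-models. -/
def noiseEvent (x : κ → EuclideanSpace ℝ ι) (S : Finset κ) (f : EuclideanSpace ℝ ι) (σ c L : ℝ) :
    Set (ι → ℝ) :=
  {z | (∀ J : Finset κ, J ≠ S →
      -(σ * ‖f - (Submodule.span ℝ (x '' J)).starProjection f‖
        * Real.sqrt (2 * (1 + c) * (((S \ J).card : ℝ) + (J \ S).card) * L))
      ≤ inner ℝ (f - (Submodule.span ℝ (x '' J)).starProjection f) (WithLp.toLp 2 z))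
    ∧ (∀ D : Finset κ, D.Nonempty → ‖((Submodule.span ℝ (x '' S))ᗮ ⊓
        Submodule.span ℝ (x '' (D ∪ S : Finset κ))).starProjection (WithLp.toLp 2 z)‖ ^ 2
      ≤ σ ^ 2 * ((6 + 4 * c) * D.card * L))
    ∧ ∀ j, |inner ℝ (columnResidual x S j) (WithLp.toLp 2 z)|
        ≤ σ * ‖columnResidual x S j‖ * Real.sqrt (2 * (c + 1) * L)}

lemma compl_noiseEvent_subset (x : κ → EuclideanSpace ℝ ι) (S : Finset κ)
    (f : EuclideanSpace ℝ ι) (σ c L : ℝ) :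
    (noiseEvent x S f σ c L)ᶜ ⊆
      (⋃ D ∈ Finset.univ.filter fun D : Finset κ => D.Nonempty,
        {z | inner ℝ (f - (Submodule.span ℝ (x '' (symmDiff D S : Finset κ))).starProjection f)
          (WithLp.toLp 2 z) < -(σ * ‖f - (Submodule.span ℝ
            (x '' (symmDiff D S : Finset κ))).starProjection f‖
              * Real.sqrt (2 * (1 + c) * D.card * L))})
      ∪ ((⋃ D ∈ Finset.univ.filter fun D : Finset κ => D.Nonempty,
        {z | σ ^ 2 * ((6 + 4 * c) * D.card * L) < ‖((Submodule.span ℝ (x '' S))ᗮ ⊓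
          Submodule.span ℝ (x '' (D ∪ S : Finset κ))).starProjection (WithLp.toLp 2 z)‖ ^ 2})
      ∪ ⋃ j ∈ (Finset.univ : Finset κ),
        {z | σ * ‖columnResidual x S j‖ * Real.sqrt (2 * (c + 1) * L)
          < |inner ℝ (columnResidual x S j) (WithLp.toLp 2 z)|}) := by
  rw [Set.compl_subset_comm]
  intro z hz
  simp only [Set.mem_compl_iff, Set.mem_union, Set.mem_iUnion, Set.mem_ofPred_eq, not_or,
    not_exists, not_lt, Finset.mem_filter, Finset.mem_univ, true_and, forall_true_left] at hz
  refine ⟨fun J hJ => ?_, hz.2.1, hz.2.2⟩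
  have hD : (symmDiff J S).Nonempty := by
    rw [Finset.nonempty_iff_ne_empty]
    exact fun h => hJ (symmDiff_eq_bot.1 h)
  have hDc : ((symmDiff J S).card : ℝ) = ((S \ J).card : ℝ) + (J \ S).card := by
    rw [← Nat.cast_add, add_comm, symmDiff, Finset.sup_eq_union,
      Finset.card_union_of_disjoint disjoint_sdiff_sdiff]
  have h := hz.1 _ hD
  rwa [symmDiff_symmDiff_cancel_right, hDc] at h

lemma measure_compl_noiseEvent_le {p : ℕ} (hp : 2 ≤ p) (hκ : Fintype.card κ = p)
    (x : κ → EuclideanSpace ℝ ι) (S : Finset κ) (f : EuclideanSpace ℝ ι) {σ c : ℝ} (hσ : 0 < σ)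
    (hc : 0 ≤ c) :
    (Measure.pi fun _ : ι => gaussianReal 0 (Real.toNNReal (σ ^ 2)))
        (noiseEvent x S f σ c (Real.log p))ᶜ
      ≤ ENNReal.ofReal (6 * (p : ℝ) ^ (-c)) := by
  have hpR : (0 : ℝ) < p := by positivity
  have hL : 0 ≤ Real.log p := Real.log_natCast_nonneg p
  have hpq : (Fintype.card κ : ℝ) * Real.exp (-((1 + c) * Real.log p)) = (p : ℝ) ^ (-c) := by
    rw [Real.rpow_def_of_pos hpR, hκ]
    nth_rewrite 1 [← Real.exp_log hpR]
    rw [← Real.exp_add]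
    congr 1
    ring
  have hpq1 : (Fintype.card κ : ℝ) * Real.exp (-((1 + c) * Real.log p)) ≤ 1 := by
    rw [hpq]
    exact Real.rpow_le_one_of_one_le_of_nonpos (by exact_mod_cast (by omega : 1 ≤ p)) (by linarith)
  have hpos : 0 ≤ (p : ℝ) ^ (-c) := by positivity
  refine (measure_mono (compl_noiseEvent_subset x S f σ c _)).trans ?_
  refine (measure_union_le _ _).trans ((add_le_add ?_
      ((measure_union_le _ _).trans (add_le_add ?_ ?_))).trans
    (b := ENNReal.ofReal (2 * (p : ℝ) ^ (-c)) + (ENNReal.ofReal (2 * (p : ℝ) ^ (-c))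
      + ENNReal.ofReal (2 * (p : ℝ) ^ (-c)))) ?_)
  · rw [← hpq]
    refine measure_iUnion_nonempty_le (Real.exp_pos _).le hpq1 fun D _ => ?_
    refine (meas_inner_pi_gaussianReal_lt_le hσ _ (Real.sqrt_nonneg _)).trans (le_of_eq ?_)
    rw [Real.sq_sqrt (by positivity), ← Real.exp_nat_mul]
    congr 2
    ring
  · rw [← hpq]
    refine measure_iUnion_nonempty_le (Real.exp_pos _).le hpq1 fun D _ => ?_
    refine le_trans (meas_lt_norm_sq_starProjection_le (m := D.card) hσ
      ((Submodule.span ℝ (x '' S))ᗮ ⊓ Submodule.span ℝ (x '' (D ∪ S : Finset κ)))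
      (finrank_orthogonal_inf_span_image_union_le S D) ((6 + 4 * c) * D.card * Real.log p)) ?_
    exact ENNReal.ofReal_le_ofReal (sqrt_two_pow_mul_exp_le hp c)
  · refine (measure_iUnion_lt_abs_inner_le hσ (Real.sqrt_nonneg _) _).trans (le_of_eq ?_)
    rw [← hpq, Real.sq_sqrt (by positivity)]
    ring_nf
  · rw [← ENNReal.ofReal_add (by positivity) (by positivity),
      ← ENNReal.ofReal_add (by positivity) (by positivity)]
    exact ENNReal.ofReal_le_ofReal (by linarith)

end NoiseEvent

theorem stmt7
    (n p : ℕ) (hn : 1 ≤ n) (hnp : n ≤ p) (hp2 : 2 ≤ p)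
    (X : Matrix (Fin n) (Fin p) ℝ)
    (hX : ∀ j, Real.sqrt (∑ i, (X i j)^2) = Real.sqrt n)
    (σ : ℝ) (hσ : 0 < σ)
    (βs : Fin p → ℝ) (sstar : ℕ) (hs1 : 1 ≤ sstar)
    (Jstar : Finset (Fin p)) (hJstar : Jstar = Finset.univ.filter (fun j => βs j ≠ 0))
    (hcard : Jstar.card = sstar)
    (P : Finset (Fin p) → (Fin n → ℝ) → (Fin n → ℝ))
    (hP : ∀ (J : Finset (Fin p)) (v : Fin n → ℝ),
        (∃ cf : Fin p → ℝ, (∀ j ∉ J, cf j = 0) ∧ P J v = X.mulVec cf)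
        ∧ ∀ j ∈ J, (∑ i, (v i - P J v i) * X i j) = 0)
    (μ : Measure (Fin n → ℝ))
    (hμ : μ = Measure.pi (fun _ : Fin n => gaussianReal 0 (Real.toNNReal (σ^2))))
    (hminimal : ∀ b : Fin p → ℝ, X.mulVec b = X.mulVec βs →
        sstar ≤ (Finset.univ.filter (fun j => b j ≠ 0)).card)
    (y : (Fin n → ℝ) → Fin n → ℝ)
    (hy : ∀ z i, y z i = X.mulVec βs i + z i)
    (sbar : ℕ) (hsbar1 : sstar ≤ sbar) (hsbar2 : sbar ≤ p)
    (lam : ℝ)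
    (w Post : (Fin n → ℝ) → Finset (Fin p) → ℝ)
    (hw : ∀ z J, w z J = if J.card ≤ sbar then
        ((p.choose J.card : ℝ))⁻¹ * Real.exp (-(lam * (J.card : ℝ)))
          * Real.exp (-(∑ i, (y z i - P J (y z) i)^2) / (2 * σ^2)) else 0)
    (hPost : ∀ z J, Post z J = w z J / ∑ J' : Finset (Fin p), w z J')
    (bh : (Fin n → ℝ) → Finset (Fin p) → Fin p → ℝ)
    (hbh : ∀ z J, (∀ j ∉ J, bh z J j = 0)
        ∧ X.mulVec (bh z J) = P J (y z)
        ∧ ∀ b : Fin p → ℝ, (∀ j ∉ J, b j = 0) → X.mulVec b = P J (y z) →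
            ∑ j, (bh z J j)^2 ≤ ∑ j, (b j)^2)
    (nu : ℝ → ℝ)
    (hnu : ∀ s : ℝ, nu s = sInf {r : ℝ | ∃ (J : Finset (Fin p)) (u : Fin p → ℝ),
        (J.card : ℝ) ≤ s ∧ (∀ j ∉ J, u j = 0) ∧ (∑ j, (u j)^2) = 1 ∧
        r = Real.sqrt (∑ i, (X.mulVec u i)^2) / Real.sqrt n})
    (ε c : ℝ) (hε : 0 < ε) (hc : 1 ≤ c)
    (hI : 0 < nu ((2 + ε) * (sstar : ℝ)))
    (hlam : lam = ((1 + ε) / ε) * (23 + 5 * c) * Real.log p)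
    (hbmin : ∀ j ∈ Jstar,
        3 * σ * Real.sqrt (lam / n) / nu ((2 + ε) * (sstar : ℝ)) ≤ |βs j|)
    :
    ENNReal.ofReal (1 - 7 * (p : ℝ) ^ (-c)) ≤
      μ {z | ∀ Jh : Finset (Fin p), (∀ J' : Finset (Fin p), Post z J' ≤ Post z Jh) →
        ∀ j, |bh z Jh j - βs j|
          ≤ σ * Real.sqrt (2 * (c + 1) * Real.log p
              / ((n : ℝ) * (nu (sstar : ℝ))^2))} := by
  have hp0 : 0 < p := by omega
  have : NeZero p := ⟨hp0.ne'⟩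
  have hpR : (0 : ℝ) < p := by exact_mod_cast hp0
  have hnR : (0 : ℝ) < n := by exact_mod_cast hn
  have hL : 0 < Real.log p := Real.log_pos (by exact_mod_cast hp2)
  set L := Real.log p with hLdef
  have hsR : (1 : ℝ) ≤ sstar := by exact_mod_cast hs1
  have hsub : ∀ j ∉ Jstar, βs j = 0 := by
    intro j hj
    by_contra h
    exact hj (by simp [hJstar, h])
  have hSne : Jstar.Nonempty := Finset.card_pos.1 (by omega)
  have hnu_le : nu ((2 + ε) * sstar) ≤ nu sstar := by
    rw [hnu, hnu sstar]
    exact restricted_eigenvalue_anti hsR (by nlinarith)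
  have hnus : 0 < nu sstar := hI.trans_le hnu_le
  have hlampos : 0 < lam := by rw [hlam]; positivity
  set x : Fin p → EuclideanSpace ℝ (Fin n) := fun j => WithLp.toLp 2 fun i => X i j with hx
  set f : EuclideanSpace ℝ (Fin n) := ∑ j, βs j • x j with hf
  have hκ0 : 0 < n * nu ((2 + ε) * sstar) ^ 2 := by positivity
  have hκs0 : 0 < n * nu sstar ^ 2 := by positivity
  have hβmin : ∀ j ∈ Jstar, 9 * σ ^ 2 * lam ≤ n * nu ((2 + ε) * sstar) ^ 2 * βs j ^ 2 := by
    intro j hj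
    have h := pow_le_pow_left₀ (by positivity) (hbmin j hj) 2
    rw [sq_abs, div_pow, mul_pow, Real.sq_sqrt (by positivity), div_le_iff₀ (by positivity)] at h
    have h2 := mul_le_mul_of_nonneg_left h hnR.le
    have h3 : n * ((3 * σ) ^ 2 * (lam / n)) = 9 * σ ^ 2 * lam := by
      field_simp
      norm_num
    linarith
  have hfy : ∀ z, (WithLp.toLp 2 (y z) : EuclideanSpace ℝ (Fin n)) = f + WithLp.toLp 2 z := by
    intro z
    rw [hf, hx, sum_smul_col_eq_toLp_mulVec]
    ext i
    simp [hy]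
  have hproj : ∀ z J, (WithLp.toLp 2 (P J (y z)) : EuclideanSpace ℝ (Fin n))
      = (Submodule.span ℝ (x '' J)).starProjection (f + WithLp.toLp 2 z) := by
    intro z J
    rw [← hfy]
    exact toLp_eq_starProjection (hP J (y z))
  have hrss : ∀ z J, ∑ i, (y z i - P J (y z) i) ^ 2
      = ‖f + WithLp.toLp 2 z
          - (Submodule.span ℝ (x '' J)).starProjection (f + WithLp.toLp 2 z)‖ ^ 2 := by
    intro z J
    rw [← hproj, ← hfy, EuclideanSpace.real_norm_sq_eq]
    rfl
  have hwpos : ∀ z, 0 < w z Jstar := by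
    intro z
    rw [hw, if_pos (by omega)]
    have : 0 < p.choose Jstar.card := Nat.choose_pos (by omega)
    positivity
  have hw0 : ∀ z J, 0 ≤ w z J := by
    intro z J
    rw [hw]
    split_ifs <;> positivity
  have hZ : ∀ z, 0 < ∑ J', w z J' := fun z =>
    Finset.sum_pos' (fun J _ => hw0 z J) ⟨Jstar, Finset.mem_univ _, hwpos z⟩
  have hevent : noiseEvent x Jstar f σ c L ⊆
      {z | ∀ Jh : Finset (Fin p), (∀ J' : Finset (Fin p), Post z J' ≤ Post z Jh) →
        ∀ j, |bh z Jh j - βs j|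
          ≤ σ * Real.sqrt (2 * (c + 1) * L / ((n : ℝ) * (nu (sstar : ℝ))^2))} := by
    rintro z ⟨hcross, hchi, hcol⟩
    rw [Set.mem_ofPred_eq]
    intro Jh hmax
    have hJh : Jh = Jstar := by
      by_contra hne
      have hlt : w z Jh < w z Jstar := by
        by_cases hc' : Jh.card ≤ sbar
        swap
        · rw [hw z Jh, if_neg hc']
          exact hwpos z
        rw [hw, hw, if_pos hc', if_pos (by omega), hrss, hrss]
        refine inv_mul_exp_mul_exp_lt (p := p) (d := (Jstar \ Jh).card + (Jh \ Jstar).card) hσ hpR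
          (Nat.cast_pos.2 (Nat.choose_pos (by omega)))
          (Nat.cast_pos.2 (Nat.choose_pos (by omega))) ?_ ?_
        · have h1 := Finset.card_sdiff_add_card Jh Jstar
          have h2 := Finset.card_sdiff_add_card Jstar Jh
          rw [Finset.union_comm] at h2
          exact_mod_cast Nat.choose_le_choose_mul_pow (by omega) (by omega) (by omega) (by omega)
        · rw [Nat.cast_add]
          refine penalized_residual_gap_pos hσ hL hc hε hlam hκ0 hSne hne ?_ hsub hβmin hf ?_ ?_
          · intro hcardU u hu
            exact restricted_eigenvalue_le hn hI.le (hnu _) (by rwa [hcard] at hcardU) hu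
          · exact hcross Jh hne
          · rcases (Jh \ Jstar).eq_empty_or_nonempty with h0 | h0
            · rw [h0]
              have hle : Submodule.span ℝ (x '' Jstar)
                  ≤ Submodule.span ℝ (x '' (∅ ∪ Jstar : Finset (Fin p))) :=
                Submodule.span_mono (Set.image_mono (by simp))
              rw [← norm_starProjection_sq_sub hle]
              simp
            · exact hchi _ h0
      have h := hmax Jstar
      rw [hPost, hPost] at h
      exact absurd h (not_le.2 (div_lt_div_of_pos_right hlt (hZ z)))
    subst hJh
    intro j
    by_cases hj : j ∈ Jh
    swap
    · rw [(hbh z Jh).1 j hj, hsub j hj, sub_zero, abs_zero]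
      positivity
    have hθ := abs_le_of_sum_smul_eq_starProjection (x := x) (S := Jh) (σ := σ)
      (t := Real.sqrt (2 * (c + 1) * L)) hκs0
      (fun u hu => restricted_eigenvalue_le hn hnus.le (hnu _) (by rw [hcard]) hu)
      (θ := fun k => bh z Jh k - βs k) (fun k hk => by simp [(hbh z Jh).1 k hk, hsub k hk])
      (z := WithLp.toLp 2 z) ?_ hj (hcol j)
    · rwa [← Real.sqrt_div (by positivity)] at hθ
    · have hfm : f ∈ Submodule.span ℝ (x '' Jh) := sum_smul_mem_span_image hsub
      have hb : ∑ k, bh z Jh k • x k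
          = (Submodule.span ℝ (x '' Jh)).starProjection (f + WithLp.toLp 2 z) := by
        rw [← hproj, ← (hbh z Jh).2.1]
        exact sum_smul_col_eq_toLp_mulVec _
      simp_rw [sub_smul, Finset.sum_sub_distrib]
      rw [hb, map_add, Submodule.starProjection_eq_self_iff.2 hfm]
      abel
  have hprob : IsProbabilityMeasure μ := by rw [hμ]; infer_instance
  have hbad : μ (noiseEvent x Jstar f σ c L)ᶜ ≤ ENNReal.ofReal (7 * (p : ℝ) ^ (-c)) := by
    rw [hμ]
    refine (measure_compl_noiseEvent_le hp2 (Fintype.card_fin p) x Jstar f hσ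
      (by linarith)).trans (ENNReal.ofReal_le_ofReal ?_)
    have : 0 ≤ (p : ℝ) ^ (-c) := by positivity
    linarith
  rw [ENNReal.ofReal_sub _ (by positivity), ENNReal.ofReal_one, tsub_le_iff_right]
  calc (1 : ℝ≥0∞) = μ (noiseEvent x Jstar f σ c L ∪ (noiseEvent x Jstar f σ c L)ᶜ) := by
        rw [Set.union_compl_self, measure_univ]
    _ ≤ _ := measure_union_le _ _
    _ ≤ _ := add_le_add (measure_mono hevent) hbad
end

section
/- Fix ε > 0 and c ≥ 1, assume Condition I((2+ε)s⋆) holds, take λ = ((1+ε)·(23 + 5c) + 1)/ε·log p, and assume min_{j ∈ J⋆} |β⋆_j| ≥ 3σ·√(λ/n)/ν_{(2+ε)s⋆}. For J ⊆ {1,…,p} nonempty let ν_J = min{‖X_J u‖₂/√n : u ∈ ℝ^{|J|}, ‖u‖₂ = 1}, let ν_min = min{ν_J : J nonempty, ν_J > 0}, and define β̃ = Σ_{J : the columns of X_J are linearly independent} Π(J)·β̂_J (including J = ∅ with β̂_∅ = 0). Then with probability at least 1 − 4p^(−c) over the Gaussian noise z: ‖β̃ − β⋆‖_∞ ≤ σ·√(2(c+1)·log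 p/(n·ν_{s⋆}²)) + (3/(ν_min·p^c))·[σ·√((20+4c)·log p/n) + ‖Xβ⋆‖₂/√n + ν_min·‖β⋆‖_∞]. -/
open MeasureTheory ProbabilityTheory Finset
open scoped Classical ENNReal

theorem lintegral_exp_dot_pi_gaussianReal {ι : Type*} [Fintype ι] (v : NNReal) (a : ι → ℝ) :
    ∫⁻ z, ENNReal.ofReal (Real.exp (∑ i, a i * z i))
        ∂Measure.pi (fun _ : ι => gaussianReal 0 v)
      = ENNReal.ofReal (Real.exp (v * (∑ i, a i ^ 2) / 2)) := by
  have hint : ∀ i, Integrable (fun x : ℝ => Real.exp (a i * x)) (gaussianReal 0 v) :=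
    fun i => integrable_exp_mul_gaussianReal (a i)
  have hval : ∀ i, ∫ x, Real.exp (a i * x) ∂gaussianReal 0 v = Real.exp (v * a i ^ 2 / 2) := by
    intro i
    have := congrFun (mgf_id_gaussianReal (μ := 0) (v := v)) (a i)
    simpa [mgf] using this
  simp_rw [Real.exp_sum]
  rw [← ofReal_integral_eq_lintegral_ofReal]
  · rw [integral_fintype_prod_eq_prod (f := fun i x => Real.exp (a i * x))]
    simp_rw [hval]
    rw [← Real.exp_sum, mul_sum, sum_div]
  · exact Integrable.fintype_prod_dep (f := fun i x => Real.exp (a i * x)) hint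
  · exact Filter.Eventually.of_forall fun z => by positivity

theorem integral_exp_sq_div_four_gaussianReal :
    ∫ x, Real.exp (x ^ 2 / 4) ∂gaussianReal 0 1 = Real.sqrt 2 := by
  rw [integral_gaussianReal_eq_integral_smul one_ne_zero]
  have : ∀ x : ℝ, gaussianPDFReal 0 1 x • Real.exp (x ^ 2 / 4)
      = (Real.sqrt (2 * Real.pi))⁻¹ * Real.exp (-(1 / 4) * x ^ 2) := by
    intro x
    simp only [gaussianPDFReal, NNReal.coe_one, mul_one, sub_zero, smul_eq_mul]
    rw [mul_assoc, ← Real.exp_add]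
    congr 2; ring
  simp_rw [this]
  rw [integral_const_mul, integral_gaussian, ← Real.sqrt_inv,
    ← Real.sqrt_mul (by positivity)]
  congr 1
  field_simp
  norm_num

theorem lintegral_exp_sq_div_four_pi_gaussianReal (ι : Type*) [Fintype ι] :
    ∫⁻ g, ENNReal.ofReal (Real.exp (∑ i, g i ^ 2 / 4))
        ∂Measure.pi (fun _ : ι => gaussianReal 0 1)
      = ENNReal.ofReal (Real.sqrt 2 ^ Fintype.card ι) := by
  have hint : Integrable (fun x : ℝ => Real.exp (x ^ 2 / 4)) (gaussianReal 0 1) := by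
    by_contra h
    have h0 := integral_undef h
    rw [integral_exp_sq_div_four_gaussianReal] at h0
    have : 0 < Real.sqrt 2 := by positivity
    linarith
  simp_rw [Real.exp_sum]
  rw [← ofReal_integral_eq_lintegral_ofReal]
  · rw [integral_fintype_prod_eq_prod (f := fun (_ : ι) (x : ℝ) => Real.exp (x ^ 2 / 4))]
    simp [integral_exp_sq_div_four_gaussianReal]
  · exact Integrable.fintype_prod_dep (f := fun (_ : ι) (x : ℝ) => Real.exp (x ^ 2 / 4))
      fun _ => hint
  · exact Filter.Eventually.of_forall fun z => by positivity

theorem lintegral_exp_sum_inner_sq {n : ℕ} {ι : Type*} [Fintype ι] {σ : ℝ} (hσ : 0 < σ)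
    {u : ι → EuclideanSpace ℝ (Fin n)} (hu : Orthonormal ℝ u) :
    ∫⁻ z, ENNReal.ofReal (Real.exp (∑ k, (inner ℝ (u k) (WithLp.toLp 2 z)) ^ 2 / (4 * σ ^ 2)))
        ∂Measure.pi (fun _ : Fin n => gaussianReal 0 (Real.toNNReal (σ ^ 2)))
      = ENNReal.ofReal (Real.sqrt 2 ^ Fintype.card ι) := by
  set s : ℝ := (Real.sqrt 2 * σ)⁻¹ with hs
  have hs2 : s ^ 2 = 1 / (2 * σ ^ 2) := by
    rw [hs, inv_pow, mul_pow, Real.sq_sqrt (by norm_num)]; simp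
  have hσ2 : ((Real.toNNReal (σ ^ 2) : NNReal) : ℝ) = σ ^ 2 := Real.coe_toNNReal _ (by positivity)
  have hinner : ∀ (k : ι) (z : Fin n → ℝ),
      inner ℝ (u k) (WithLp.toLp 2 z) = ∑ i, u k i * z i := by
    intro k z
    simp [PiLp.inner_apply, mul_comm]
  have h1 : ∀ z : Fin n → ℝ,
      ENNReal.ofReal (Real.exp (∑ k, (inner ℝ (u k) (WithLp.toLp 2 z)) ^ 2 / (4 * σ ^ 2)))
      = ∫⁻ g, ENNReal.ofReal (Real.exp (∑ k, (s * inner ℝ (u k) (WithLp.toLp 2 z)) * g k))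
          ∂Measure.pi (fun _ : ι => gaussianReal 0 1) := by
    intro z
    rw [lintegral_exp_dot_pi_gaussianReal]
    congr 2
    simp only [NNReal.coe_one, one_mul, mul_pow, hs2]
    rw [sum_div]
    refine sum_congr rfl fun k _ => ?_
    field_simp
    norm_num
  have h2 : ∀ g : ι → ℝ,
      ∫⁻ z, ENNReal.ofReal (Real.exp (∑ k, (s * inner ℝ (u k) (WithLp.toLp 2 z)) * g k))
        ∂Measure.pi (fun _ : Fin n => gaussianReal 0 (Real.toNNReal (σ ^ 2)))
      = ENNReal.ofReal (Real.exp (∑ k, g k ^ 2 / 4)) := by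
    intro g
    have hz : ∀ z : Fin n → ℝ, ∑ k, (s * inner ℝ (u k) (WithLp.toLp 2 z)) * g k
        = ∑ i, (s * (∑ k, g k • u k) i) * z i := by
      intro z
      simp only [hinner, mul_sum, sum_mul, WithLp.ofLp_sum, Finset.sum_apply,
        WithLp.ofLp_smul, Pi.smul_apply, smul_eq_mul]
      rw [sum_comm]
      exact sum_congr rfl fun _ _ => sum_congr rfl fun _ _ => by ring
    simp_rw [hz]
    rw [lintegral_exp_dot_pi_gaussianReal, hσ2]
    have hn : ∑ i, (∑ k, g k • u k) i ^ 2 = ∑ k, g k ^ 2 := by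
      rw [← EuclideanSpace.real_norm_sq_eq, ← real_inner_self_eq_norm_sq, hu.inner_sum]
      simp [sq]
    congr 2
    simp only [mul_pow]
    rw [← mul_sum, hn, hs2, ← sum_div]
    field_simp
    ring
  simp_rw [h1]
  rw [lintegral_lintegral_swap]
  · simp_rw [h2]
    exact lintegral_exp_sq_div_four_pi_gaussianReal ι
  · refine Measurable.aemeasurable ?_
    simp_rw [hinner]
    unfold Function.uncurry
    fun_prop

theorem pi_gaussianReal_norm_starProjection_sq_gt_le {n m : ℕ} {σ : ℝ} (hσ : 0 < σ)
    (S : Submodule ℝ (EuclideanSpace ℝ (Fin n))) (hS : Module.finrank ℝ S ≤ m) (T : ℝ) :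
    Measure.pi (fun _ : Fin n => gaussianReal 0 (Real.toNNReal (σ ^ 2)))
        {z | σ ^ 2 * T < ‖S.starProjection (WithLp.toLp 2 z)‖ ^ 2}
      ≤ ENNReal.ofReal (Real.sqrt 2 ^ m * Real.exp (-T / 4)) := by
  set b := stdOrthonormalBasis ℝ S
  have hu : Orthonormal ℝ (fun k => (b k : EuclideanSpace ℝ (Fin n))) :=
    b.orthonormal.comp_linearIsometry S.subtypeₗᵢ
  have hnorm : ∀ x, ‖S.starProjection x‖ ^ 2
      = ∑ k, (inner ℝ (b k : EuclideanSpace ℝ (Fin n)) x) ^ 2 := by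
    intro x
    have h1 : ‖S.starProjection x‖ = ‖S.orthogonalProjectionOnto x‖ := rfl
    rw [h1, ← b.sum_sq_norm_inner_right]
    refine sum_congr rfl fun k _ => ?_
    rw [Real.norm_eq_abs, sq_abs, Submodule.inner_orthogonalProjectionOnto_eq_of_mem_left]
  have key := lintegral_exp_sum_inner_sq hσ hu
  have hmeas : Measurable fun z : Fin n → ℝ => ENNReal.ofReal (Real.exp
      (∑ k, (inner ℝ (b k : EuclideanSpace ℝ (Fin n)) (WithLp.toLp 2 z)) ^ 2 / (4 * σ ^ 2))) := by
    fun_prop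
  have hmk := mul_meas_ge_le_lintegral
    (μ := Measure.pi (fun _ : Fin n => gaussianReal 0 (Real.toNNReal (σ ^ 2)))) hmeas
    (ENNReal.ofReal (Real.exp (T / 4)))
  rw [key] at hmk
  have hcard : Real.sqrt 2 ^ Fintype.card (Fin (Module.finrank ℝ S)) ≤ Real.sqrt 2 ^ m := by
    rw [Fintype.card_fin]
    exact pow_le_pow_right₀ (Real.one_le_sqrt.2 (by norm_num)) hS
  calc _ ≤ Measure.pi (fun _ : Fin n => gaussianReal 0 (Real.toNNReal (σ ^ 2)))
        {z | ENNReal.ofReal (Real.exp (T / 4)) ≤ ENNReal.ofReal (Real.exp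
      (∑ k, (inner ℝ (b k : EuclideanSpace ℝ (Fin n)) (WithLp.toLp 2 z)) ^ 2 / (4 * σ ^ 2)))} := by
        refine measure_mono fun z hz => ?_
        simp only [Set.mem_ofPred_eq] at hz ⊢
        rw [hnorm] at hz
        refine ENNReal.ofReal_le_ofReal (Real.exp_le_exp.2 ?_)
        rw [← sum_div, div_le_div_iff₀ (by norm_num) (by positivity)]
        linarith
    _ ≤ ENNReal.ofReal (Real.sqrt 2 ^ m) / ENNReal.ofReal (Real.exp (T / 4)) := by
        rw [ENNReal.le_div_iff_mul_le (Or.inl (by positivity)) (Or.inl ENNReal.ofReal_ne_top),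
          mul_comm]
        exact hmk.trans (ENNReal.ofReal_le_ofReal hcard)
    _ = _ := by
        rw [← ENNReal.ofReal_div_of_pos (Real.exp_pos _), neg_div, Real.exp_neg, div_eq_mul_inv]

theorem pi_gaussianReal_abs_inner_gt_le {n : ℕ} {σ : ℝ} (hσ : 0 < σ)
    (a : EuclideanSpace ℝ (Fin n)) {t : ℝ} (ht : 0 ≤ t) :
    Measure.pi (fun _ : Fin n => gaussianReal 0 (Real.toNNReal (σ ^ 2)))
        {z | ‖a‖ * (σ * t) < |inner ℝ a (WithLp.toLp 2 z)|}
      ≤ ENNReal.ofReal (2 * Real.exp (-t ^ 2 / 2)) := by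
  set μ := Measure.pi (fun _ : Fin n => gaussianReal 0 (Real.toNNReal (σ ^ 2)))
  have hσ2 : ((Real.toNNReal (σ ^ 2) : NNReal) : ℝ) = σ ^ 2 := Real.coe_toNNReal _ (by positivity)
  have one_sided : ∀ a : EuclideanSpace ℝ (Fin n), a ≠ 0 →
      μ {z | ‖a‖ * (σ * t) < inner ℝ a (WithLp.toLp 2 z)}
        ≤ ENNReal.ofReal (Real.exp (-t ^ 2 / 2)) := by
    intro a ha
    have hna : 0 < ‖a‖ := norm_pos_iff.2 ha
    set r : ℝ := t / (σ * ‖a‖) with hr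
    have hr0 : 0 ≤ r := by positivity
    have hmeas : Measurable fun z : Fin n → ℝ =>
        ENNReal.ofReal (Real.exp (∑ i, (r * a i) * z i)) := by fun_prop
    have hmk := mul_meas_ge_le_lintegral (μ := μ) hmeas (ENNReal.ofReal (Real.exp (t ^ 2)))
    have hval : Real.exp (σ ^ 2 * (∑ i, (r * a i) ^ 2) / 2) = Real.exp (t ^ 2 / 2) := by
      simp only [mul_pow]
      rw [← mul_sum, ← EuclideanSpace.real_norm_sq_eq, hr]
      congr 1
      field_simp
    rw [lintegral_exp_dot_pi_gaussianReal, hσ2, hval] at hmk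
    calc _ ≤ μ {z | ENNReal.ofReal (Real.exp (t ^ 2))
              ≤ ENNReal.ofReal (Real.exp (∑ i, (r * a i) * z i))} := by
          refine measure_mono fun z hz => ?_
          simp only [Set.mem_ofPred_eq] at hz ⊢
          refine ENNReal.ofReal_le_ofReal (Real.exp_le_exp.2 ?_)
          have h1 : ∑ i, (r * a i) * z i = r * inner ℝ a (WithLp.toLp 2 z) := by
            simp [PiLp.inner_apply, mul_sum]
            exact sum_congr rfl fun _ _ => by ring
          have h2 : t ^ 2 = r * (‖a‖ * (σ * t)) := by
            rw [hr]; field_simp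
          rw [h1, h2]
          exact mul_le_mul_of_nonneg_left hz.le hr0
      _ ≤ ENNReal.ofReal (Real.exp (t ^ 2 / 2)) / ENNReal.ofReal (Real.exp (t ^ 2)) := by
          rw [ENNReal.le_div_iff_mul_le (Or.inl (by positivity)) (Or.inl ENNReal.ofReal_ne_top),
            mul_comm]
          exact hmk
      _ = _ := by
          rw [← ENNReal.ofReal_div_of_pos (Real.exp_pos _), ← Real.exp_sub]
          congr 2; ring
  rcases eq_or_ne a 0 with rfl | ha
  · simp
  · calc _ ≤ μ ({z | ‖a‖ * (σ * t) < inner ℝ a (WithLp.toLp 2 z)}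
              ∪ {z | ‖-a‖ * (σ * t) < inner ℝ (-a) (WithLp.toLp 2 z)}) := by
          refine measure_mono fun z hz => ?_
          simp only [Set.mem_ofPred_eq, Set.mem_union, norm_neg, inner_neg_left] at hz ⊢
          exact lt_abs.1 hz
      _ ≤ _ := (measure_union_le _ _).trans
          (add_le_add (one_sided a ha) (one_sided (-a) (neg_ne_zero.2 ha)))
      _ = _ := by
          rw [← ENNReal.ofReal_add (by positivity) (by positivity), two_mul]

section Projections

variable {E : Type*} [NormedAddCommGroup E] [InnerProductSpace ℝ E] [FiniteDimensional ℝ E]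

theorem starProjection_orthogonal_inf_eq_sub {S T : Submodule ℝ E} (h : S ≤ T) (z : E) :
    (Sᗮ ⊓ T).starProjection z = T.starProjection z - S.starProjection z := by
  refine Submodule.eq_starProjection_of_mem_of_inner_eq_zero ⟨?_, ?_⟩ ?_
  · have h1 := Submodule.sub_starProjection_mem_orthogonal (K := S) z
    have h2 := Submodule.orthogonal_le h (Submodule.sub_starProjection_mem_orthogonal (K := T) z)
    have := Sᗮ.sub_mem h1 h2
    simpa using this
  · exact T.sub_mem (T.starProjection_apply_mem z) (h (S.starProjection_apply_mem z))
  · rintro w ⟨hw1, hw2⟩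
    have h1 := T.starProjection_inner_eq_zero z w hw2
    have h2 : inner ℝ (S.starProjection z) w = 0 := hw1 _ (S.starProjection_apply_mem z)
    have h3 : z - (T.starProjection z - S.starProjection z)
        = (z - T.starProjection z) + S.starProjection z := by abel
    rw [h3, inner_add_left, h1, h2, add_zero]

theorem norm_starProjection_sq_add_norm_sub_sq (S : Submodule ℝ E) (z : E) :
    ‖S.starProjection z‖ ^ 2 + ‖z - S.starProjection z‖ ^ 2 = ‖z‖ ^ 2 := by
  have h : inner ℝ (S.starProjection z) (z - S.starProjection z) = 0 := by
    rw [real_inner_comm]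
    exact S.starProjection_inner_eq_zero z _ (S.starProjection_apply_mem z)
  have h2 := norm_add_sq_real (S.starProjection z) (z - S.starProjection z)
  rw [h, add_sub_cancel] at h2
  linarith

theorem norm_starProjection_orthogonal_inf_sq {S T : Submodule ℝ E} (h : S ≤ T) (z : E) :
    ‖(Sᗮ ⊓ T).starProjection z‖ ^ 2
      = ‖T.starProjection z‖ ^ 2 - ‖S.starProjection z‖ ^ 2 := by
  rw [starProjection_orthogonal_inf_eq_sub h]
  have h1 : inner ℝ (T.starProjection z) (S.starProjection z) = ‖S.starProjection z‖ ^ 2 := by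
    rw [← real_inner_self_eq_norm_sq, ← sub_eq_zero, ← inner_sub_left,
      ← starProjection_orthogonal_inf_eq_sub h]
    rw [real_inner_comm]
    exact ((Sᗮ ⊓ T).starProjection_apply_mem z).1 _ (S.starProjection_apply_mem z)
  rw [norm_sub_sq_real, h1]
  ring

theorem norm_starProjection_sq_le_of_le {S T : Submodule ℝ E} (h : S ≤ T) (z : E) :
    ‖S.starProjection z‖ ^ 2 ≤ ‖T.starProjection z‖ ^ 2 := by
  have := norm_starProjection_orthogonal_inf_sq h z
  nlinarith [sq_nonneg ‖(Sᗮ ⊓ T).starProjection z‖]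

theorem norm_sub_starProjection_add_sq (S : Submodule ℝ E) (f z : E) :
    ‖(f + z) - S.starProjection (f + z)‖ ^ 2
      = ‖f - S.starProjection f‖ ^ 2 + 2 * inner ℝ (f - S.starProjection f) z
        + (‖z‖ ^ 2 - ‖S.starProjection z‖ ^ 2) := by
  have h1 : (f + z) - S.starProjection (f + z)
      = (f - S.starProjection f) + (z - S.starProjection z) := by
    rw [map_add]; abel
  have h2 : inner ℝ (f - S.starProjection f) (S.starProjection z) = 0 :=
    S.starProjection_inner_eq_zero f _ (S.starProjection_apply_mem z)
  have h3 := norm_starProjection_sq_add_norm_sub_sq S z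
  rw [h1, norm_add_sq_real, inner_sub_right, h2]
  linarith

theorem norm_sub_starProjection_sq_of_mem {S : Submodule ℝ E} {f : E} (hf : f ∈ S) (z : E) :
    ‖(f + z) - S.starProjection (f + z)‖ ^ 2 = ‖z‖ ^ 2 - ‖S.starProjection z‖ ^ 2 := by
  rw [norm_sub_starProjection_add_sq, Submodule.starProjection_eq_self_iff.2 hf]
  simp

theorem norm_sub_starProjection_add_sq_ge {S T : Submodule ℝ E} (h : S ≤ T) {f : E} (hf : f ∈ T)
    (z : E) :
    ‖z‖ ^ 2 - ‖T.starProjection z‖ ^ 2 ≤ ‖(f + z) - S.starProjection (f + z)‖ ^ 2 := by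
  have h1 := norm_sub_starProjection_sq_of_mem hf z
  have h2 := norm_starProjection_sq_add_norm_sub_sq S (f + z)
  have h3 := norm_starProjection_sq_add_norm_sub_sq T (f + z)
  have h4 := norm_starProjection_sq_le_of_le h (f + z)
  linarith

end Projections

/-- The span of the vectors `x j` for `j ∈ J`. -/
noncomputable def columnSpan {ι E : Type*} [AddCommGroup E] [Module ℝ E] (x : ι → E)
    (J : Finset ι) : Submodule ℝ E :=
  Submodule.span ℝ (x '' J)

section ColumnSpan

variable {ι E : Type*} [AddCommGroup E] [Module ℝ E] (x : ι → E)

theorem columnSpan_mono {J K : Finset ι} (h : J ⊆ K) : columnSpan x J ≤ columnSpan x K :=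
  Submodule.span_mono (Set.image_mono (by exact_mod_cast h))

theorem columnSpan_empty : columnSpan x ∅ = ⊥ := by
  simp [columnSpan]

theorem columnSpan_union [DecidableEq ι] (J K : Finset ι) :
    columnSpan x (J ∪ K) = columnSpan x J ⊔ columnSpan x K := by
  simp [columnSpan, Set.image_union, Submodule.span_union]

theorem finrank_columnSpan_le (J : Finset ι) :
    Module.finrank ℝ (columnSpan x J) ≤ J.card := by
  have h := finrank_span_finset_le_card (R := ℝ) (J.image x)
  rw [coe_image] at h
  exact h.trans card_image_le

theorem sum_smul_mem_columnSpan [Fintype ι] {J : Finset ι} {b : ι → ℝ} (hb : ∀ j ∉ J, b j = 0) :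
    ∑ j, b j • x j ∈ columnSpan x J := by
  refine Submodule.sum_mem _ fun j _ => ?_
  by_cases hj : j ∈ J
  · exact Submodule.smul_mem _ _ (Submodule.subset_span ⟨j, hj, rfl⟩)
  · simp [hb j hj]

theorem mem_columnSpan_of_mem {J : Finset ι} {j : ι} (hj : j ∈ J) : x j ∈ columnSpan x J :=
  Submodule.subset_span ⟨j, hj, rfl⟩

theorem exists_sum_smul_of_mem_columnSpan [Fintype ι] {J : Finset ι} {v : E}
    (hv : v ∈ columnSpan x J) :
    ∃ b : ι → ℝ, (∀ j ∉ J, b j = 0) ∧ v = ∑ j, b j • x j := by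
  induction hv using Submodule.span_induction with
  | mem v hv =>
    obtain ⟨j, hj, rfl⟩ := hv
    refine ⟨Pi.single j 1, fun k hk => ?_, ?_⟩
    · rw [Pi.single_eq_of_ne]
      rintro rfl
      exact hk hj
    · simp [Pi.single_apply]
  | zero => exact ⟨0, by simp, by simp⟩
  | add u v _ _ hu hv =>
    obtain ⟨b, hb, rfl⟩ := hu
    obtain ⟨b', hb', rfl⟩ := hv
    exact ⟨b + b', fun j hj => by simp [hb j hj, hb' j hj], by simp [add_smul, sum_add_distrib]⟩
  | smul r v _ hv =>
    obtain ⟨b, hb, rfl⟩ := hv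
    exact ⟨r • b, fun j hj => by simp [hb j hj], by simp [smul_smul, smul_sum]⟩

end ColumnSpan

theorem finrank_orthogonal_inf_columnSpan_le {ι E : Type*} [DecidableEq ι] [NormedAddCommGroup E]
    [InnerProductSpace ℝ E] [FiniteDimensional ℝ E] (x : ι → E) (D B : Finset ι) :
    Module.finrank ℝ ↥((columnSpan x B)ᗮ ⊓ columnSpan x (D ∪ B)) ≤ D.card := by
  have h1 := Submodule.finrank_add_inf_finrank_orthogonal
    (columnSpan_mono x (subset_union_right : B ⊆ D ∪ B))
  have h2 := Submodule.finrank_add_le_finrank_add_finrank (columnSpan x D) (columnSpan x B)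
  rw [← columnSpan_union] at h2
  have h3 := finrank_columnSpan_le x D
  omega

theorem sum_pow_card_symmDiff_eq {p : ℕ} (B : Finset (Fin p)) (q : ℝ) :
    ∑ J : Finset (Fin p), q ^ (symmDiff J B).card = (1 + q) ^ p := by
  have hinv : Function.Involutive fun J : Finset (Fin p) => symmDiff J B :=
    fun J => symmDiff_symmDiff_cancel_right B J
  have hsum := Equiv.sum_comp hinv.toPerm (fun J => q ^ J.card)
  simp only [Function.Involutive.coe_toPerm] at hsum
  rw [hsum]
  have := Fintype.sum_pow_mul_eq_add_pow (Fin p) q 1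
  simpa [add_comm] using this

theorem sum_pow_card_symmDiff_le {p : ℕ} (B : Finset (Fin p)) {q : ℝ} (hq : 0 ≤ q)
    (hpq : p * q ≤ 1) :
    ∑ J ∈ univ.erase B, q ^ (symmDiff J B).card ≤ 2 * (p * q) := by
  have h1 := sum_pow_card_symmDiff_eq B q
  rw [← add_sum_erase _ _ (mem_univ B)] at h1
  simp only [symmDiff_self, bot_eq_empty, card_empty, pow_zero] at h1
  have h2 : (1 + q) ^ p ≤ Real.exp (p * q) := by
    rw [Real.exp_nat_mul]
    exact pow_le_pow_left₀ (by linarith) (by linarith [Real.add_one_le_exp q]) p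
  have h0 : 0 ≤ p * q := by positivity
  have h3 := Real.norm_exp_sub_one_sub_id_le (x := p * q)
    (by rw [Real.norm_eq_abs, abs_of_nonneg h0]; exact hpq)
  rw [Real.norm_eq_abs, Real.norm_eq_abs, abs_of_nonneg h0] at h3
  have h4 := (abs_le.1 h3).2
  nlinarith

theorem sum_pow_card_le {p : ℕ} {q : ℝ} (hq : 0 ≤ q) (hpq : p * q ≤ 1) :
    ∑ J ∈ univ.erase (∅ : Finset (Fin p)), q ^ J.card ≤ 2 * (p * q) := by
  have h := sum_pow_card_symmDiff_le (∅ : Finset (Fin p)) hq hpq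
  simpa only [← bot_eq_empty, symmDiff_bot] using h

theorem measure_exists_mem_le_ofReal_sum {α ι : Type*} [MeasurableSpace α] (μ : Measure α)
    (s : Finset ι) (A : ι → α → Prop) {f : ι → ℝ} (hf : ∀ i ∈ s, 0 ≤ f i)
    (hA : ∀ i ∈ s, μ {z | A i z} ≤ ENNReal.ofReal (f i)) :
    μ {z | ∃ i ∈ s, A i z} ≤ ENNReal.ofReal (∑ i ∈ s, f i) := by
  have h : {z | ∃ i ∈ s, A i z} = ⋃ i ∈ s, {z | A i z} := by ext; simp
  rw [h, ENNReal.ofReal_sum_of_nonneg hf]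
  exact (measure_biUnion_finset_le _ _).trans (sum_le_sum hA)

theorem exp_neg_nat_mul_log {p : ℕ} (hp : 2 ≤ p) (k : ℕ) :
    Real.exp (-(k * Real.log p)) = ((p : ℝ)⁻¹) ^ k := by
  rw [Real.exp_neg, Real.exp_nat_mul, Real.exp_log (by positivity), inv_pow]

theorem pi_gaussianReal_exists_projection_gt_le {n p : ℕ} (hp : 2 ≤ p) {σ c : ℝ} (hσ : 0 < σ)
    (hc : 0 ≤ c) (x : Fin p → EuclideanSpace ℝ (Fin n)) (B : Finset (Fin p)) :
    Measure.pi (fun _ : Fin n => gaussianReal 0 (Real.toNNReal (σ ^ 2)))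
        {z | ∃ D ∈ univ.erase (∅ : Finset (Fin p)),
          σ ^ 2 * ((20 + 4 * c) * D.card * Real.log p)
            < ‖(columnSpan x (D ∪ B)).starProjection (WithLp.toLp 2 z)‖ ^ 2
              - ‖(columnSpan x B).starProjection (WithLp.toLp 2 z)‖ ^ 2}
      ≤ ENNReal.ofReal ((p : ℝ) ^ (-c) / 2) := by
  have hp0 : (0 : ℝ) < p := by positivity
  have hp2 : (2 : ℝ) ≤ p := by exact_mod_cast hp
  set q : ℝ := Real.sqrt 2 * Real.exp (-((5 + c) * Real.log p)) with hq
  have hq0 : 0 ≤ q := by positivity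
  have hqle : p * q ≤ (p : ℝ) ^ (-c) * (1 / 8) := by
    have h1 : Real.exp (-((5 + c) * Real.log p)) = (p : ℝ) ^ (-c) * (p : ℝ)⁻¹ ^ 5 := by
      rw [← exp_neg_nat_mul_log hp, Real.rpow_def_of_pos hp0, ← Real.exp_add]
      congr 1; push_cast; ring
    have h2 : Real.sqrt 2 ≤ p := (Real.sqrt_le_left (by norm_num)).2 (by norm_num) |>.trans hp2
    have h3 : (p : ℝ)⁻¹ ≤ 1 / 2 := by
      rw [inv_eq_one_div]; exact one_div_le_one_div_of_le (by norm_num) hp2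
    have h4 : (p : ℝ)⁻¹ ^ 3 ≤ (1 / 2) ^ 3 := pow_le_pow_left₀ (by positivity) h3 3
    calc p * q = (p : ℝ) ^ (-c) * (Real.sqrt 2 * (p * (p : ℝ)⁻¹ ^ 5)) := by rw [hq, h1]; ring
      _ ≤ (p : ℝ) ^ (-c) * (p * (p * (p : ℝ)⁻¹ ^ 5)) := by gcongr
      _ = (p : ℝ) ^ (-c) * (p : ℝ)⁻¹ ^ 3 := by field_simp
      _ ≤ (p : ℝ) ^ (-c) * (1 / 8) := by
        refine mul_le_mul_of_nonneg_left ?_ (by positivity)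
        norm_num at h4 ⊢; exact h4
  have hpc : (p : ℝ) ^ (-c) ≤ 1 :=
    Real.rpow_le_one_of_one_le_of_nonpos (by linarith) (by linarith)
  refine (measure_exists_mem_le_ofReal_sum _ _ (fun D z => σ ^ 2 *
    ((20 + 4 * c) * D.card * Real.log p)
      < ‖(columnSpan x (D ∪ B)).starProjection (WithLp.toLp 2 z)‖ ^ 2
        - ‖(columnSpan x B).starProjection (WithLp.toLp 2 z)‖ ^ 2)
    (f := fun D => q ^ D.card) (fun _ _ => by positivity) fun D _ => ?_).trans
    (ENNReal.ofReal_le_ofReal ?_)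
  swap
  · have h0 : 0 ≤ (p : ℝ) ^ (-c) := by positivity
    have := sum_pow_card_le hq0 (by linarith)
    linarith
  have h := pi_gaussianReal_norm_starProjection_sq_gt_le hσ _
    (finrank_orthogonal_inf_columnSpan_le x D B) ((20 + 4 * c) * D.card * Real.log p)
  refine (measure_mono fun z hz => ?_).trans (h.trans_eq ?_)
  · exact lt_of_lt_of_eq hz (norm_starProjection_orthogonal_inf_sq (columnSpan_mono x
      (subset_union_right : B ⊆ D ∪ B)) _).symm
  rw [hq, mul_pow, ← Real.exp_nat_mul]
  congr 3; ring

theorem pi_gaussianReal_exists_inner_gt_le {n p : ℕ} (hp : 2 ≤ p) {σ c : ℝ} (hσ : 0 < σ)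
    (hc : 0 ≤ c) (r : Finset (Fin p) → EuclideanSpace ℝ (Fin n)) (B : Finset (Fin p)) :
    Measure.pi (fun _ : Fin n => gaussianReal 0 (Real.toNNReal (σ ^ 2)))
        {z | ∃ J ∈ univ.erase B,
          ‖r J‖ * (σ * Real.sqrt (2 * (3 + c) * (symmDiff J B).card * Real.log p))
            < |inner ℝ (r J) (WithLp.toLp 2 z)|}
      ≤ ENNReal.ofReal ((p : ℝ) ^ (-c)) := by
  have hp0 : (0 : ℝ) < p := by positivity
  have hp2 : (2 : ℝ) ≤ p := by exact_mod_cast hp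
  have hL : 0 ≤ Real.log p := Real.log_nonneg (by linarith)
  set q : ℝ := Real.exp (-((3 + c) * Real.log p)) with hq
  have hq0 : 0 ≤ q := by positivity
  have hqle : p * q ≤ (p : ℝ) ^ (-c) * (1 / 4) := by
    have h1 : Real.exp (-((3 + c) * Real.log p)) = (p : ℝ) ^ (-c) * (p : ℝ)⁻¹ ^ 3 := by
      rw [← exp_neg_nat_mul_log hp, Real.rpow_def_of_pos hp0, ← Real.exp_add]
      congr 1; push_cast; ring
    have h3 : (p : ℝ)⁻¹ ≤ 1 / 2 := by
      rw [inv_eq_one_div]; exact one_div_le_one_div_of_le (by norm_num) hp2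
    have h4 : (p : ℝ)⁻¹ ^ 2 ≤ (1 / 2) ^ 2 := pow_le_pow_left₀ (by positivity) h3 2
    calc p * q = (p : ℝ) ^ (-c) * (p : ℝ)⁻¹ ^ 2 := by rw [hq, h1]; field_simp
      _ ≤ (p : ℝ) ^ (-c) * (1 / 4) := by
        refine mul_le_mul_of_nonneg_left ?_ (by positivity)
        norm_num at h4 ⊢; exact h4
  have hpc : (p : ℝ) ^ (-c) ≤ 1 :=
    Real.rpow_le_one_of_one_le_of_nonpos (by linarith) (by linarith)
  have hpc0 : 0 ≤ (p : ℝ) ^ (-c) := by positivity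
  refine (measure_exists_mem_le_ofReal_sum _ _ (fun J z =>
    ‖r J‖ * (σ * Real.sqrt (2 * (3 + c) * (symmDiff J B).card * Real.log p))
      < |inner ℝ (r J) (WithLp.toLp 2 z)|)
    (f := fun J => 2 * q ^ (symmDiff J B).card) (fun _ _ => by positivity) fun J _ => ?_).trans
    (ENNReal.ofReal_le_ofReal ?_)
  · refine (pi_gaussianReal_abs_inner_gt_le hσ (r J) (Real.sqrt_nonneg _)).trans_eq ?_
    rw [Real.sq_sqrt (by positivity), hq, ← Real.exp_nat_mul]
    congr 3; ring
  · rw [← mul_sum]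
    have := sum_pow_card_symmDiff_le B hq0 (by linarith)
    linarith

theorem pi_gaussianReal_exists_index_inner_gt_le {n p : ℕ} (hp : 2 ≤ p) {σ c : ℝ} (hσ : 0 < σ)
    (hc : 0 ≤ c) (r : Fin p → EuclideanSpace ℝ (Fin n)) :
    Measure.pi (fun _ : Fin n => gaussianReal 0 (Real.toNNReal (σ ^ 2)))
        {z | ∃ j ∈ (univ : Finset (Fin p)), ‖r j‖ * (σ * Real.sqrt (2 * (c + 1) * Real.log p))
            < |inner ℝ (r j) (WithLp.toLp 2 z)|}
      ≤ ENNReal.ofReal (2 * (p : ℝ) ^ (-c)) := by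
  have hp0 : (0 : ℝ) < p := by positivity
  have hp2 : (2 : ℝ) ≤ p := by exact_mod_cast hp
  have hL : 0 ≤ Real.log p := Real.log_nonneg (by linarith)
  refine (measure_exists_mem_le_ofReal_sum _ _ (fun j z =>
    ‖r j‖ * (σ * Real.sqrt (2 * (c + 1) * Real.log p)) < |inner ℝ (r j) (WithLp.toLp 2 z)|)
    (f := fun _ => 2 * ((p : ℝ) ^ (-c) * (p : ℝ)⁻¹)) (fun _ _ => by positivity)
    fun j _ => ?_).trans_eq ?_
  · refine (pi_gaussianReal_abs_inner_gt_le hσ (r j) (Real.sqrt_nonneg _)).trans_eq ?_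
    have h1 := exp_neg_nat_mul_log hp 1
    rw [pow_one] at h1
    rw [Real.sq_sqrt (by positivity), ← h1, Real.rpow_def_of_pos hp0, ← Real.exp_add]
    congr 3; push_cast; ring
  · rw [sum_const, card_univ, Fintype.card_fin, nsmul_eq_mul]
    congr 1; field_simp

theorem choose_succ_le_mul_choose (p k : ℕ) : p.choose (k + 1) ≤ p * p.choose k := by
  have h := Nat.choose_succ_right_eq p k
  calc p.choose (k + 1) ≤ p.choose (k + 1) * (k + 1) := Nat.le_mul_of_pos_right _ k.succ_pos
    _ = p.choose k * (p - k) := h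
    _ ≤ p * p.choose k := by
      rw [mul_comm]; exact Nat.mul_le_mul_right _ (Nat.sub_le _ _)

theorem choose_le_mul_choose_succ {p k : ℕ} (hk : k < p) :
    p.choose k ≤ p * p.choose (k + 1) := by
  have h := Nat.choose_succ_right_eq p k
  calc p.choose k ≤ p.choose k * (p - k) := Nat.le_mul_of_pos_right _ (Nat.sub_pos_of_lt hk)
    _ = p.choose (k + 1) * (k + 1) := h.symm
    _ ≤ p * p.choose (k + 1) := by
      rw [mul_comm]; exact Nat.mul_le_mul_right _ hk

theorem choose_add_le_pow_mul_choose (p k e : ℕ) :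
    p.choose (k + e) ≤ p ^ e * p.choose k := by
  induction e with
  | zero => simp
  | succ e ih =>
    calc p.choose (k + e + 1) ≤ p * p.choose (k + e) := choose_succ_le_mul_choose p (k + e)
      _ ≤ p * (p ^ e * p.choose k) := Nat.mul_le_mul_left _ ih
      _ = p ^ (e + 1) * p.choose k := by ring

theorem choose_le_pow_mul_choose_add {p k e : ℕ} (h : k + e ≤ p) :
    p.choose k ≤ p ^ e * p.choose (k + e) := by
  induction e with
  | zero => simp
  | succ e ih =>
    calc p.choose k ≤ p ^ e * p.choose (k + e) := ih (by omega)
      _ ≤ p ^ e * (p * p.choose (k + e + 1)) :=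
        Nat.mul_le_mul_left _ (choose_le_mul_choose_succ (by omega))
      _ = p ^ (e + 1) * p.choose (k + (e + 1)) := by rw [← add_assoc]; ring

theorem choose_card_le_pow_symmDiff_mul {p : ℕ} (hp : 1 ≤ p) (J B : Finset (Fin p)) :
    p.choose B.card ≤ p ^ (symmDiff J B).card * p.choose J.card := by
  have h1 : J.card ≤ B.card + (symmDiff J B).card := by
    refine (card_le_card fun j hj => ?_).trans (card_union_le _ _)
    simp only [mem_union, mem_symmDiff]; tauto
  have h2 : B.card ≤ J.card + (symmDiff J B).card := by
    refine (card_le_card fun j hj => ?_).trans (card_union_le _ _)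
    simp only [mem_union, mem_symmDiff]; tauto
  have hJ : J.card ≤ p := by simpa using card_le_univ J
  rcases le_total J.card B.card with h | h
  · obtain ⟨e, he⟩ := Nat.exists_eq_add_of_le h
    rw [he]
    exact (choose_add_le_pow_mul_choose p _ e).trans
      (Nat.mul_le_mul_right _ (Nat.pow_le_pow_right hp (by omega)))
  · obtain ⟨e, he⟩ := Nat.exists_eq_add_of_le h
    have h3 := choose_le_pow_mul_choose_add (p := p) (k := B.card) (e := e) (by omega)
    rw [he]
    exact h3.trans (Nat.mul_le_mul_right _ (Nat.pow_le_pow_right hp (by omega)))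

theorem mul_inv_choose_mul_exp_le {p : ℕ} (hp : 2 ≤ p) {J B : Finset (Fin p)} (hne : J ≠ B)
    {c a b : ℝ}
    (h : (6 + c) * (symmDiff J B).card * Real.log p ≤ a - b) :
    p * (((p.choose J.card : ℕ) : ℝ)⁻¹ * Real.exp (-a))
      ≤ Real.exp (-((4 + c) * Real.log p)) ^ (symmDiff J B).card
        * (((p.choose B.card : ℕ) : ℝ)⁻¹ * Real.exp (-b)) := by
  set d := (symmDiff J B).card with hd
  have hd1 : 1 ≤ d := by
    rw [hd, Nat.one_le_iff_ne_zero, Ne, card_eq_zero, ← bot_eq_empty, symmDiff_eq_bot]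
    exact hne
  have hp0 : (0 : ℝ) < p := by positivity
  have hp1 : (1 : ℝ) ≤ p := by exact_mod_cast (by omega : 1 ≤ p)
  have hJ : 0 < ((p.choose J.card : ℕ) : ℝ) := by
    exact_mod_cast Nat.choose_pos (by simpa using card_le_univ J)
  have hB : 0 < ((p.choose B.card : ℕ) : ℝ) := by
    exact_mod_cast Nat.choose_pos (by simpa using card_le_univ B)
  have h1 : ((p.choose B.card : ℕ) : ℝ) ≤ (p : ℝ) ^ d * ((p.choose J.card : ℕ) : ℝ) := by
    exact_mod_cast choose_card_le_pow_symmDiff_mul (by omega) J B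
  have h2 : ((p.choose J.card : ℕ) : ℝ)⁻¹ ≤ (p : ℝ) ^ d * ((p.choose B.card : ℕ) : ℝ)⁻¹ := by
    rw [← div_eq_mul_inv, inv_eq_one_div, div_le_div_iff₀ hJ hB]
    linarith
  have h3 : Real.exp (-a) ≤ Real.exp (-((6 + c) * d * Real.log p)) * Real.exp (-b) := by
    rw [← Real.exp_add]
    exact Real.exp_le_exp.2 (by linarith)
  have h4 : (p : ℝ) ≤ (p : ℝ) ^ d := le_self_pow₀ hp1 (by omega)
  have h5 : (p : ℝ) ^ d * (p : ℝ) ^ d * Real.exp (-((6 + c) * d * Real.log p))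
      = Real.exp (-((4 + c) * Real.log p)) ^ d := by
    have : (p : ℝ) ^ d = Real.exp (d * Real.log p) := by
      rw [Real.exp_nat_mul, Real.exp_log hp0]
    rw [this, ← Real.exp_nat_mul, ← Real.exp_add, ← Real.exp_add]
    congr 1; ring
  calc p * (((p.choose J.card : ℕ) : ℝ)⁻¹ * Real.exp (-a))
      ≤ (p : ℝ) ^ d * (((p : ℝ) ^ d * ((p.choose B.card : ℕ) : ℝ)⁻¹)
        * (Real.exp (-((6 + c) * d * Real.log p)) * Real.exp (-b))) := by gcongr
    _ = _ := by rw [← h5]; ring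

theorem sum_erase_mul_div_sum_le {p : ℕ} (hp : 2 ≤ p) {c : ℝ} (hc : 0 ≤ c)
    (W : Finset (Fin p) → ℝ) (B : Finset (Fin p)) (hW : ∀ J, 0 ≤ W J) (hB : 0 < W B)
    (h : ∀ J ≠ B, p * W J ≤ Real.exp (-((4 + c) * Real.log p)) ^ (symmDiff J B).card * W B) :
    ∑ J ∈ univ.erase B, p * (W J / ∑ J', W J') ≤ (p : ℝ) ^ (-c) := by
  have hp0 : (0 : ℝ) < p := by positivity
  have hp2 : (2 : ℝ) ≤ p := by exact_mod_cast hp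
  have hZ : W B ≤ ∑ J', W J' := single_le_sum (fun J _ => hW J) (mem_univ B)
  set q : ℝ := Real.exp (-((4 + c) * Real.log p)) with hq
  have hpc : (p : ℝ) ^ (-c) ≤ 1 :=
    Real.rpow_le_one_of_one_le_of_nonpos (by linarith) (by linarith)
  have hpc0 : 0 ≤ (p : ℝ) ^ (-c) := by positivity
  have hqle : p * q ≤ (p : ℝ) ^ (-c) * (1 / 2) := by
    have h1 : q = (p : ℝ) ^ (-c) * (p : ℝ)⁻¹ ^ 4 := by
      rw [hq, ← exp_neg_nat_mul_log hp, Real.rpow_def_of_pos hp0, ← Real.exp_add]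
      congr 1; push_cast; ring
    have h3 : (p : ℝ)⁻¹ ≤ 1 / 2 := by
      rw [inv_eq_one_div]; exact one_div_le_one_div_of_le (by norm_num) hp2
    have h4 : (p : ℝ)⁻¹ ^ 3 ≤ (1 / 2) ^ 3 := pow_le_pow_left₀ (by positivity) h3 3
    calc p * q = (p : ℝ) ^ (-c) * (p : ℝ)⁻¹ ^ 3 := by rw [h1]; field_simp
      _ ≤ (p : ℝ) ^ (-c) * (1 / 2) := by
        refine mul_le_mul_of_nonneg_left (h4.trans (by norm_num)) hpc0
  have hsum := sum_pow_card_symmDiff_le B (Real.exp_pos _).le (by linarith : (p : ℝ) * q ≤ 1)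
  refine (sum_le_sum (g := fun J => q ^ (symmDiff J B).card) fun J hJ => ?_).trans
    (hsum.trans (by linarith))
  rw [← mul_div_assoc, div_le_iff₀ (hB.trans_le hZ)]
  exact (h J (ne_of_mem_erase hJ)).trans (by gcongr)

section ResidualSumOfSquares

variable {E : Type*} [NormedAddCommGroup E] [InnerProductSpace ℝ E] [FiniteDimensional ℝ E]

theorem mul_card_sdiff_le_norm_sub_starProjection_sq {p : ℕ} (x : Fin p → E)
    {J B : Finset (Fin p)} {κ b : ℝ} {β : Fin p → ℝ}
    (hκ : ∀ u : Fin p → ℝ, (∀ j ∉ J ∪ B, u j = 0) →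
      κ ^ 2 * ∑ j, u j ^ 2 ≤ ‖∑ j, u j • x j‖ ^ 2)
    (hβ : ∀ j ∉ B, β j = 0) (hb : 0 ≤ b) (hmin : ∀ j ∈ B, b ≤ |β j|) :
    κ ^ 2 * b ^ 2 * ((B \ J).card : ℝ)
      ≤ ‖(∑ j, β j • x j) - (columnSpan x J).starProjection (∑ j, β j • x j)‖ ^ 2 := by
  obtain ⟨a, ha, hPa⟩ := exists_sum_smul_of_mem_columnSpan x
    ((columnSpan x J).starProjection_apply_mem (∑ j, β j • x j))
  have h1 := hκ (fun j => β j - a j) fun j hj => by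
    rw [mem_union, not_or] at hj
    simp [hβ j hj.2, ha j hj.1]
  simp only [sub_smul, sum_sub_distrib] at h1
  rw [hPa]
  refine le_trans ?_ h1
  rw [mul_assoc]
  refine mul_le_mul_of_nonneg_left ?_ (sq_nonneg κ)
  calc b ^ 2 * ((B \ J).card : ℝ) = ∑ j ∈ B \ J, b ^ 2 := by
        rw [sum_const, nsmul_eq_mul, mul_comm]
    _ ≤ ∑ j ∈ B \ J, (β j - a j) ^ 2 := by
        refine sum_le_sum fun j hj => ?_
        rw [mem_sdiff] at hj
        rw [ha j hj.2, sub_zero, ← sq_abs (β j)]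
        exact pow_le_pow_left₀ hb (hmin j hj.1) 2
    _ ≤ ∑ j, (β j - a j) ^ 2 :=
        sum_le_sum_of_subset_of_nonneg (subset_univ _) fun _ _ _ => sq_nonneg _

theorem neg_le_residual_sub_residual {p : ℕ} (x : Fin p → E) {J B : Finset (Fin p)} {f z : E}
    {A : ℝ} (hf : f ∈ columnSpan x B)
    (hA : ‖(columnSpan x ((J \ B) ∪ B)).starProjection z‖ ^ 2
      - ‖(columnSpan x B).starProjection z‖ ^ 2 ≤ A) :
    -A ≤ ‖(f + z) - (columnSpan x J).starProjection (f + z)‖ ^ 2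
      - ‖(f + z) - (columnSpan x B).starProjection (f + z)‖ ^ 2 := by
  have hJ : J ⊆ (J \ B) ∪ B := by
    intro j hj
    simp only [mem_union, mem_sdiff]; tauto
  have h1 := norm_sub_starProjection_add_sq_ge (columnSpan_mono x hJ)
    (columnSpan_mono x (subset_union_right : B ⊆ (J \ B) ∪ B) hf) z
  have h2 := norm_sub_starProjection_sq_of_mem hf z
  linarith

theorem half_norm_sq_sub_le_residual_sub_residual {p : ℕ} (x : Fin p → E)
    {J B : Finset (Fin p)} {f z : E} {A t : ℝ} (hf : f ∈ columnSpan x B)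
    (hA : ‖(columnSpan x ((J \ B) ∪ B)).starProjection z‖ ^ 2
      - ‖(columnSpan x B).starProjection z‖ ^ 2 ≤ A)
    (ht : |inner ℝ (f - (columnSpan x J).starProjection f) z|
      ≤ ‖f - (columnSpan x J).starProjection f‖ * t) :
    ‖f - (columnSpan x J).starProjection f‖ ^ 2 / 2 - 2 * t ^ 2 - A
      ≤ ‖(f + z) - (columnSpan x J).starProjection (f + z)‖ ^ 2
      - ‖(f + z) - (columnSpan x B).starProjection (f + z)‖ ^ 2 := by
  have hJ : J ⊆ (J \ B) ∪ B := by
    intro j hj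
    simp only [mem_union, mem_sdiff]; tauto
  have h1 := norm_starProjection_sq_le_of_le (columnSpan_mono x hJ) z
  have h2 := norm_sub_starProjection_sq_of_mem hf z
  have h3 := norm_sub_starProjection_add_sq (columnSpan x J) f z
  have h4 := (abs_le.1 ht).1
  nlinarith [sq_nonneg (‖f - (columnSpan x J).starProjection f‖ - 2 * t)]

end ResidualSumOfSquares

theorem card_symmDiff_eq_add {ι : Type*} [DecidableEq ι] (J B : Finset ι) :
    (symmDiff J B).card = (J \ B).card + (B \ J).card := by
  rw [symmDiff_def, sup_eq_union]
  exact card_union_of_disjoint disjoint_sdiff_sdiff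

theorem penalized_residual_gap {E : Type*} [NormedAddCommGroup E] [InnerProductSpace ℝ E]
    [FiniteDimensional ℝ E] {p : ℕ} (x : Fin p → E) {J B : Finset (Fin p)}
    {β : Fin p → ℝ} {z : E} {σ c ε lam L ν : ℝ} (hσ : 0 < σ) (hc : 1 ≤ c) (hε : 0 < ε)
    (hL : 0 ≤ L) (hlam : lam = (((1 + ε) * (23 + 5 * c) + 1) / ε) * L) (hν : 0 < ν)
    (hνle : ∀ u : Fin p → ℝ, ((J ∪ B).card : ℝ) ≤ (2 + ε) * B.card → (∀ j ∉ J ∪ B, u j = 0) →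
      ν ^ 2 * ∑ j, u j ^ 2 ≤ ‖∑ j, u j • x j‖ ^ 2)
    (hβ : ∀ j ∉ B, β j = 0) (hmin : ∀ j ∈ B, 3 * σ * Real.sqrt lam / ν ≤ |β j|)
    (hA : ‖(columnSpan x ((J \ B) ∪ B)).starProjection z‖ ^ 2
      - ‖(columnSpan x B).starProjection z‖ ^ 2 ≤ σ ^ 2 * ((20 + 4 * c) * (J \ B).card * L))
    (ht : |inner ℝ ((∑ j, β j • x j) - (columnSpan x J).starProjection (∑ j, β j • x j)) z|
      ≤ ‖(∑ j, β j • x j) - (columnSpan x J).starProjection (∑ j, β j • x j)‖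
        * (σ * Real.sqrt (2 * (3 + c) * (symmDiff J B).card * L))) :
    (6 + c) * (symmDiff J B).card * L
      ≤ (lam * J.card + ‖((∑ j, β j • x j) + z)
          - (columnSpan x J).starProjection ((∑ j, β j • x j) + z)‖ ^ 2 / (2 * σ ^ 2))
        - (lam * B.card + ‖((∑ j, β j • x j) + z)
          - (columnSpan x B).starProjection ((∑ j, β j • x j) + z)‖ ^ 2 / (2 * σ ^ 2)) := by
  set f := ∑ j, β j • x j with hf_def
  have hf : f ∈ columnSpan x B := sum_smul_mem_columnSpan x hβ
  have hd : ((symmDiff J B).card : ℝ) = (J \ B).card + (B \ J).card := by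
    exact_mod_cast card_symmDiff_eq_add J B
  have hJB : (J.card : ℝ) + (B \ J).card = B.card + (J \ B).card := by
    have h1 := card_sdiff_add_card J B
    have h2 := card_sdiff_add_card B J
    rw [union_comm] at h2
    exact_mod_cast (by omega : J.card + (B \ J).card = B.card + (J \ B).card)
  have hmJ : ((J \ B).card : ℝ) ≤ J.card := by exact_mod_cast card_le_card sdiff_subset
  have hkB : ((B \ J).card : ℝ) ≤ B.card := by exact_mod_cast card_le_card sdiff_subset
  have hUB : ((J ∪ B).card : ℝ) ≤ J.card + B.card := by exact_mod_cast card_union_le J B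
  have hm0 : (0 : ℝ) ≤ (J \ B).card := Nat.cast_nonneg _
  have hk0 : (0 : ℝ) ≤ (B \ J).card := Nat.cast_nonneg _
  have hlamε : lam * ε = ((1 + ε) * (23 + 5 * c) + 1) * L := by rw [hlam]; field_simp
  have hlamge : (23 + 5 * c) * L ≤ lam := by
    refine le_of_mul_le_mul_right ?_ hε
    rw [hlamε]
    nlinarith
  have hlam0 : 0 ≤ lam := le_trans (by positivity) hlamge
  have hsplit : ∀ a b : ℝ, (lam * J.card + a / (2 * σ ^ 2)) - (lam * B.card + b / (2 * σ ^ 2))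
      = lam * (J.card - B.card) + (a - b) / (2 * σ ^ 2) := fun a b => by ring
  rw [hsplit, hd]
  rcases lt_or_ge ((1 + ε) * (B.card : ℝ)) J.card with hlarge | hsmall
  · have h1 := neg_le_residual_sub_residual x hf hA
    have h2 : -((10 + 2 * c) * (J \ B).card * L)
        ≤ (‖(f + z) - (columnSpan x J).starProjection (f + z)‖ ^ 2
          - ‖(f + z) - (columnSpan x B).starProjection (f + z)‖ ^ 2) / (2 * σ ^ 2) := by
      rw [le_div_iff₀ (by positivity)]
      linarith
    have h3 : (23 + 5 * c) * J.card * L ≤ lam * (J.card - B.card) := by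
      have h4 : lam * (ε * J.card / (1 + ε)) ≤ lam * (J.card - B.card) := by
        refine mul_le_mul_of_nonneg_left ?_ hlam0
        rw [div_le_iff₀ (by positivity)]
        linarith
      refine le_trans ?_ h4
      rw [← mul_div_assoc, le_div_iff₀ (by positivity), ← mul_assoc, hlamε]
      have : 0 ≤ L * J.card := by positivity
      nlinarith
    have h4 : (10 + 2 * c) * (J \ B).card * L ≤ (10 + 2 * c) * J.card * L := by gcongr
    have hBJ : (B.card : ℝ) ≤ J.card := by nlinarith [(Nat.cast_nonneg B.card : (0 : ℝ) ≤ _)]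
    have h5 : (6 + c) * ((J \ B).card + (B \ J).card) * L ≤ (6 + c) * (J.card + J.card) * L :=
      mul_le_mul_of_nonneg_right (mul_le_mul_of_nonneg_left (by linarith) (by linarith)) hL
    have h6 : 0 ≤ J.card * L := by positivity
    have h7 : 0 ≤ c * (J.card * L) := by positivity
    linarith
  · have h1 := half_norm_sq_sub_le_residual_sub_residual x hf hA ht
    have h2 := mul_card_sdiff_le_norm_sub_starProjection_sq x
      (hνle · (by linarith)) hβ (by positivity) hmin
    have h3 : ν ^ 2 * (3 * σ * Real.sqrt lam / ν) ^ 2 = 9 * σ ^ 2 * lam := by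
      rw [div_pow, mul_pow, mul_pow, Real.sq_sqrt hlam0]
      field_simp
      ring
    rw [h3, ← hf_def] at h2
    rw [mul_pow, Real.sq_sqrt (by positivity), hd] at h1
    have h4 : 9 / 4 * lam * (B \ J).card - 2 * (3 + c) * ((J \ B).card + (B \ J).card) * L
        - (10 + 2 * c) * (J \ B).card * L
        ≤ (‖(f + z) - (columnSpan x J).starProjection (f + z)‖ ^ 2
          - ‖(f + z) - (columnSpan x B).starProjection (f + z)‖ ^ 2) / (2 * σ ^ 2) := by
      rw [le_div_iff₀ (by positivity)]
      linarith
    have h5 : lam * (J.card - B.card) = lam * (J \ B).card - lam * (B \ J).card := by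
      rw [← mul_sub]; congr 1; linarith
    have h6 := mul_le_mul_of_nonneg_right hlamge hm0
    have h7 := mul_le_mul_of_nonneg_right hlamge hk0
    have h8 : 0 ≤ (J \ B).card * L := by positivity
    have h9 : 0 ≤ (B \ J).card * L := by positivity
    have h10 : 0 ≤ c * ((B \ J).card * L) := by positivity
    rw [h5]
    linarith

theorem mul_abs_coeff_le_of_abs_inner_le {E : Type*} [NormedAddCommGroup E]
    [InnerProductSpace ℝ E] [FiniteDimensional ℝ E] {p : ℕ} (x : Fin p → E) {B : Finset (Fin p)}
    {κ T : ℝ} {h : Fin p → ℝ} {z : E} (hκ0 : 0 < κ)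
    (hκ : ∀ u : Fin p → ℝ, (∀ j ∉ B, u j = 0) → κ ^ 2 * ∑ j, u j ^ 2 ≤ ‖∑ j, u j • x j‖ ^ 2)
    (hh : ∀ j ∉ B, h j = 0) (hz : ∑ j, h j • x j = (columnSpan x B).starProjection z)
    {j : Fin p} (hj : j ∈ B)
    (hT : |inner ℝ (x j - (columnSpan x (B.erase j)).starProjection (x j)) z|
      ≤ ‖x j - (columnSpan x (B.erase j)).starProjection (x j)‖ * T) :
    κ * |h j| ≤ T := by
  set r := x j - (columnSpan x (B.erase j)).starProjection (x j) with hr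
  have hBj : B.erase j ∪ {j} = B := by
    rw [union_comm, ← insert_eq, insert_erase hj]
  have hκr : κ ≤ ‖r‖ := by
    have h1 := mul_card_sdiff_le_norm_sub_starProjection_sq x (J := B.erase j) (B := {j})
      (κ := κ) (b := 1) (β := Pi.single j 1) (by rwa [hBj])
      (fun k hk => Pi.single_eq_of_ne (by simpa using hk) _) zero_le_one
      (fun k hk => by rw [mem_singleton.1 hk]; simp)
    have h2 : ∑ k, (Pi.single j (1 : ℝ) : Fin p → ℝ) k • x k = x j := by
      simp [Pi.single_apply]
    have h3 : ({j} : Finset (Fin p)) \ B.erase j = {j} := by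
      ext k; simp only [mem_sdiff, mem_singleton, mem_erase]; tauto
    rw [h2, h3, ← hr] at h1
    simp only [one_pow, mul_one, card_singleton, Nat.cast_one] at h1
    exact le_of_sq_le_sq h1 (norm_nonneg r)
  have hrmem : r ∈ columnSpan x B :=
    Submodule.sub_mem _ (mem_columnSpan_of_mem x hj)
      (columnSpan_mono x (erase_subset j B) (Submodule.starProjection_apply_mem _ _))
  have hperp : ∀ v ∈ columnSpan x (B.erase j), inner ℝ r v = 0 := fun v hv =>
    (columnSpan x (B.erase j)).starProjection_inner_eq_zero (x j) v hv
  have hrr : inner ℝ r (x j) = ‖r‖ ^ 2 := by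
    have h1 : x j = r + (columnSpan x (B.erase j)).starProjection (x j) := by rw [hr]; abel
    conv_lhs => rw [h1]
    rw [inner_add_right, hperp _ (Submodule.starProjection_apply_mem _ _), add_zero,
      real_inner_self_eq_norm_sq]
  have hinner : inner ℝ r z = h j * ‖r‖ ^ 2 := by
    have h1 : inner ℝ r z = inner ℝ r ((columnSpan x B).starProjection z) := by
      rw [← sub_eq_zero, ← inner_sub_right, real_inner_comm]
      exact (columnSpan x B).starProjection_inner_eq_zero z r hrmem
    rw [h1, ← hz, inner_sum, sum_eq_single j]
    · rw [inner_smul_right, hrr]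
    · intro k _ hk
      rw [inner_smul_right]
      by_cases hkB : k ∈ B
      · rw [hperp _ (mem_columnSpan_of_mem x (mem_erase.2 ⟨hk, hkB⟩)), mul_zero]
      · rw [hh k hkB, zero_mul]
    · simp
  have hr0 : 0 < ‖r‖ := hκ0.trans_le hκr
  rw [hinner, abs_mul, abs_of_nonneg (sq_nonneg ‖r‖)] at hT
  have h1 : |h j| * ‖r‖ ≤ T := by
    refine le_of_mul_le_mul_left ?_ hr0
    linarith
  calc κ * |h j| ≤ ‖r‖ * |h j| := by gcongr
    _ ≤ T := by linarith

theorem linearIndependent_of_mul_sum_sq_le {E : Type*} [NormedAddCommGroup E]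
    [InnerProductSpace ℝ E] {p : ℕ} (x : Fin p → E) {B : Finset (Fin p)} {κ : ℝ} (hκ0 : 0 < κ)
    (hκ : ∀ u : Fin p → ℝ, (∀ j ∉ B, u j = 0) → κ * ∑ j, u j ^ 2 ≤ ‖∑ j, u j • x j‖ ^ 2) :
    LinearIndependent ℝ fun j : B => x j := by
  rw [Fintype.linearIndependent_iff]
  intro g hg
  have h1 := hκ (fun j => if h : j ∈ B then g ⟨j, h⟩ else 0) fun j hj => dif_neg hj
  have h2 : ∑ j, (if h : j ∈ B then g ⟨j, h⟩ else 0) • x j = ∑ j : B, g j • x j := by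
    rw [← sum_subset (subset_univ B) fun j _ hj => by rw [dif_neg hj, zero_smul],
      ← sum_coe_sort]
    exact sum_congr rfl fun j _ => by rw [dif_pos j.2]
  rw [h2, hg, norm_zero, zero_pow two_ne_zero] at h1
  have h3 : ∑ j, (if h : j ∈ B then g ⟨j, h⟩ else 0) ^ 2 = 0 := by
    refine le_antisymm ?_ (sum_nonneg fun _ _ => sq_nonneg _)
    by_contra! h
    exact absurd h1 (not_le.2 (mul_pos hκ0 h))
  intro j
  have h4 := (sum_eq_zero_iff_of_nonneg fun _ _ => sq_nonneg _).1 h3 j (mem_univ _)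
  simpa using h4

theorem LinearIndependent.exists_pos_sum_sq_le {E : Type*} [NormedAddCommGroup E]
    [InnerProductSpace ℝ E] [FiniteDimensional ℝ E] {p : ℕ} {x : Fin p → E} {B : Finset (Fin p)}
    (hx : LinearIndependent ℝ fun j : B => x j) :
    ∃ K : ℝ, 0 < K ∧ ∀ u : Fin p → ℝ, (∀ j ∉ B, u j = 0) →
      Real.sqrt (∑ j, u j ^ 2) ≤ K * ‖∑ j, u j • x j‖ := by
  let g : EuclideanSpace ℝ B →ₗ[ℝ] E :=
    Fintype.linearCombination ℝ (fun j : B => x j) ∘ₗ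
      (WithLp.linearEquiv 2 ℝ (B → ℝ)).toLinearMap
  have hker : LinearMap.ker g = ⊥ := by
    rw [LinearMap.ker_eq_bot]
    exact hx.fintypeLinearCombination_injective.comp (WithLp.linearEquiv 2 ℝ _).injective
  obtain ⟨K, hK, hg⟩ := LinearMap.exists_antilipschitzWith g hker
  refine ⟨K, by exact_mod_cast hK, fun u hu => ?_⟩
  have h1 := hg.le_mul_dist (WithLp.toLp 2 fun j : B => u j) 0
  rw [map_zero, dist_zero_right, dist_zero_right, EuclideanSpace.norm_eq] at h1
  have h2 : g (WithLp.toLp 2 fun j : B => u j) = ∑ j, u j • x j := by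
    change Fintype.linearCombination ℝ (fun j : B => x j) (fun j : B => u j) = _
    rw [Fintype.linearCombination_apply, sum_coe_sort B fun j => u j • x j]
    exact sum_subset (subset_univ B) fun j _ hj => by rw [hu j hj, zero_smul]
  have h3 : ∑ j : B, ‖u j‖ ^ 2 = ∑ j, u j ^ 2 := by
    simp only [Real.norm_eq_abs, sq_abs]
    rw [sum_coe_sort B fun j => u j ^ 2]
    exact sum_subset (subset_univ B) fun j _ hj => by rw [hu j hj]; norm_num
  rw [h2] at h1
  simp only [h3] at h1
  exact h1

theorem abs_sum_filter_mul_sub_le {ι : Type*} [Fintype ι] [DecidableEq ι] {S : Finset ι}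
    {B : ι} (hB : B ∈ S)
    {P b : ι → ℝ} {β T M N q r : ℝ} (hP : ∀ J, 0 ≤ P J) (hP1 : ∑ J, P J = 1) (hr : 1 ≤ r)
    (hq : ∑ J ∈ univ.erase B, r * P J ≤ q) (hT : |b B - β| ≤ T)
    (hM : ∀ J ∈ S, |b J| ≤ r * M) (hN : |β| ≤ N) :
    |(∑ J ∈ S, P J * b J) - β| ≤ T + q * (M + N) := by
  have hM0 : 0 ≤ M := by
    have := (abs_nonneg _).trans (hM B hB)
    by_contra! h
    nlinarith
  have hN0 : 0 ≤ N := (abs_nonneg β).trans hN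
  have hT0 : 0 ≤ T := (abs_nonneg _).trans hT
  have hsplit := add_sum_erase univ P (mem_univ B)
  rw [hP1] at hsplit
  have hPB1 : P B ≤ 1 := by
    have : 0 ≤ ∑ J ∈ univ.erase B, P J := sum_nonneg fun J _ => hP J
    linarith
  have heq : (∑ J ∈ S, P J * b J) - β
      = P B * (b B - β) + (∑ J ∈ S.erase B, P J * b J) - (∑ J ∈ univ.erase B, P J) * β := by
    rw [← add_sum_erase S _ hB]
    have : ∑ J ∈ univ.erase B, P J = 1 - P B := by linarith
    rw [this]; ring
  have h1 : |P B * (b B - β)| ≤ T := by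
    rw [abs_mul, abs_of_nonneg (hP B)]
    nlinarith [hP B]
  have h2 : |∑ J ∈ S.erase B, P J * b J| ≤ q * M := by
    calc _ ≤ ∑ J ∈ S.erase B, |P J * b J| := abs_sum_le_sum_abs _ _
      _ ≤ ∑ J ∈ S.erase B, r * P J * M := by
        refine sum_le_sum fun J hJ => ?_
        rw [abs_mul, abs_of_nonneg (hP J)]
        have := mul_le_mul_of_nonneg_left (hM J (mem_of_mem_erase hJ)) (hP J)
        linarith
      _ ≤ ∑ J ∈ univ.erase B, r * P J * M :=
        sum_le_sum_of_subset_of_nonneg (erase_subset_erase _ (subset_univ S))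
          fun J _ _ => mul_nonneg (mul_nonneg (by linarith) (hP J)) hM0
      _ ≤ q * M := by rw [← sum_mul]; gcongr
  have h3 : |(∑ J ∈ univ.erase B, P J) * β| ≤ q * N := by
    have h0 : 0 ≤ ∑ J ∈ univ.erase B, P J := sum_nonneg fun J _ => hP J
    rw [abs_mul, abs_of_nonneg h0]
    rw [← mul_sum] at hq
    exact mul_le_mul (by nlinarith) hN (abs_nonneg _) (by nlinarith)
  rw [heq]
  calc _ ≤ |P B * (b B - β)| + |∑ J ∈ S.erase B, P J * b J|
        + |(∑ J ∈ univ.erase B, P J) * β| :=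
        (abs_sub _ _).trans (add_le_add_left (abs_add_le _ _) _)
    _ ≤ _ := by linarith

section DesignMatrix

variable {n p : ℕ} (X : Matrix (Fin n) (Fin p) ℝ)

theorem toLp_mulVec_eq_sum_smul (b : Fin p → ℝ) :
    WithLp.toLp 2 (X.mulVec b) = ∑ j, b j • (WithLp.toLp 2 fun i => X i j) := by
  ext i
  simp [Matrix.mulVec, dotProduct, mul_comm]

theorem sum_mulVec_sq_eq_norm_sq (b : Fin p → ℝ) :
    ∑ i, X.mulVec b i ^ 2 = ‖∑ j, b j • (WithLp.toLp 2 fun i => X i j)‖ ^ 2 := by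
  rw [← toLp_mulVec_eq_sum_smul, EuclideanSpace.real_norm_sq_eq]

theorem toLp_eq_starProjection_columnSpan {J : Finset (Fin p)} {v w : Fin n → ℝ}
    (hw : ∃ cf : Fin p → ℝ, (∀ j ∉ J, cf j = 0) ∧ w = X.mulVec cf)
    (hvw : ∀ j ∈ J, ∑ i, (v i - w i) * X i j = 0) :
    WithLp.toLp 2 w
      = (columnSpan (fun j => WithLp.toLp 2 fun i => X i j) J).starProjection
          (WithLp.toLp 2 v : EuclideanSpace ℝ (Fin n)) := by
  symm
  obtain ⟨cf, hcf, rfl⟩ := hw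
  refine Submodule.eq_starProjection_of_mem_of_inner_eq_zero ?_ ?_
  · rw [toLp_mulVec_eq_sum_smul]
    exact sum_smul_mem_columnSpan _ hcf
  · intro u hu
    obtain ⟨b, hb, rfl⟩ := exists_sum_smul_of_mem_columnSpan _ hu
    rw [inner_sum]
    refine sum_eq_zero fun j _ => ?_
    rw [inner_smul_right]
    by_cases hj : j ∈ J
    · rw [← WithLp.toLp_sub, PiLp.inner_apply]
      have := hvw j hj
      simp only [RCLike.inner_apply, conj_trivial, Pi.sub_apply] at this ⊢
      rw [mul_eq_zero]; right
      rw [← this]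
      exact sum_congr rfl fun _ _ => mul_comm _ _
    · rw [hb j hj, zero_mul]

theorem mul_sInf_sq_mul_sum_sq_le (hn : 1 ≤ n) {S : Set ℝ} (hS : ∀ r ∈ S, 0 ≤ r)
    {u : Fin p → ℝ}
    (hu : ∀ t : ℝ, ∑ j, (t * u j) ^ 2 = 1 →
      Real.sqrt (∑ i, X.mulVec (fun j => t * u j) i ^ 2) / Real.sqrt n ∈ S) :
    n * sInf S ^ 2 * ∑ j, u j ^ 2 ≤ ∑ i, X.mulVec u i ^ 2 := by
  have hn0 : (0 : ℝ) < n := by positivity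
  rcases (sum_nonneg fun j _ => sq_nonneg (u j) : 0 ≤ ∑ j, u j ^ 2).eq_or_lt with h0 | h0
  · rw [← h0, mul_zero]
    positivity
  set t : ℝ := (Real.sqrt (∑ j, u j ^ 2))⁻¹ with ht
  have ht2 : t ^ 2 * ∑ j, u j ^ 2 = 1 := by
    rw [ht, inv_pow, Real.sq_sqrt h0.le, inv_mul_cancel₀ h0.ne']
  have h1 : ∑ j, (t * u j) ^ 2 = 1 := by
    simp only [mul_pow]; rw [← mul_sum, ht2]
  have h2 := csInf_le ⟨0, fun r hr => hS r hr⟩ (hu t h1)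
  have h3 : 0 ≤ sInf S := Real.sInf_nonneg hS
  have h4 : ∑ i, X.mulVec (fun j => t * u j) i ^ 2 = t ^ 2 * ∑ i, X.mulVec u i ^ 2 := by
    have : (fun j => t * u j) = t • u := rfl
    rw [this, Matrix.mulVec_smul, mul_sum]
    simp [mul_pow]
  have h5 := pow_le_pow_left₀ h3 h2 2
  rw [h4, div_pow, Real.sq_sqrt (by positivity), Real.sq_sqrt hn0.le, le_div_iff₀ hn0] at h5
  have h6 := mul_le_mul_of_nonneg_right h5 h0.le
  calc n * sInf S ^ 2 * ∑ j, u j ^ 2 = sInf S ^ 2 * n * ∑ j, u j ^ 2 := by ring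
    _ ≤ t ^ 2 * (∑ i, X.mulVec u i ^ 2) * ∑ j, u j ^ 2 := h6
    _ = (t ^ 2 * ∑ j, u j ^ 2) * ∑ i, X.mulVec u i ^ 2 := by ring
    _ = _ := by rw [ht2, one_mul]

end DesignMatrix

theorem LinearIndependent.sInf_singular_value_pos {n p : ℕ} (hn : 1 ≤ n)
    {X : Matrix (Fin n) (Fin p) ℝ} {J : Finset (Fin p)} (hJ : J.Nonempty)
    (hX : LinearIndependent ℝ fun j : J =>
      (WithLp.toLp 2 fun i => X i j : EuclideanSpace ℝ (Fin n))) :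
    0 < sInf {r : ℝ | ∃ u : Fin p → ℝ, (∀ j ∉ J, u j = 0) ∧ (∑ j, (u j) ^ 2) = 1 ∧
      r = Real.sqrt (∑ i, (X.mulVec u i) ^ 2) / Real.sqrt n} := by
  obtain ⟨K, hK, h⟩ :=
    hX.exists_pos_sum_sq_le (x := fun j => (WithLp.toLp 2 fun i => X i j))
  have hn0 : 0 < Real.sqrt n := Real.sqrt_pos.2 (by positivity)
  refine lt_of_lt_of_le (by positivity : 0 < K⁻¹ / Real.sqrt n) (le_csInf ?_ ?_)
  · obtain ⟨j, hj⟩ := hJ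
    refine ⟨_, Pi.single j 1, fun k hk => ?_, ?_, rfl⟩
    · exact Pi.single_eq_of_ne (by rintro rfl; exact hk hj) _
    · simp [Pi.single_apply]
  · rintro _ ⟨u, hu, hu1, rfl⟩
    have h1 := h u hu
    rw [hu1, Real.sqrt_one] at h1
    rw [sum_mulVec_sq_eq_norm_sq, Real.sqrt_sq (norm_nonneg _)]
    gcongr
    rwa [inv_le_iff_one_le_mul₀' hK]

theorem sInf_pos_and_le_of_finite_range {ι : Type*} [Finite ι] {Q : ι → Prop} {f : ι → ℝ} {i : ι}
    (hi : Q i) (hf : 0 < f i) :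
    0 < sInf {r : ℝ | ∃ j, Q j ∧ 0 < f j ∧ r = f j} ∧
      sInf {r : ℝ | ∃ j, Q j ∧ 0 < f j ∧ r = f j} ≤ f i := by
  have hfin : {r : ℝ | ∃ j, Q j ∧ 0 < f j ∧ r = f j}.Finite :=
    (Set.finite_range f).subset (by rintro _ ⟨j, _, _, rfl⟩; exact ⟨j, rfl⟩)
  have hmem : f i ∈ {r : ℝ | ∃ j, Q j ∧ 0 < f j ∧ r = f j} := ⟨i, hi, hf, rfl⟩
  refine ⟨?_, csInf_le hfin.bddBelow hmem⟩
  obtain ⟨j, _, hj, h⟩ := Set.Nonempty.csInf_mem ⟨_, hmem⟩ hfin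
  rw [h]
  exact hj

theorem ofReal_one_sub_le_measure {α : Type*} [MeasurableSpace α] (μ : Measure α)
    [IsProbabilityMeasure μ] {A G : Set α} {q : ℝ} (hq : 0 ≤ q) (hA : μ A ≤ ENNReal.ofReal q)
    (hG : ∀ z, z ∉ A → z ∈ G) : ENNReal.ofReal (1 - q) ≤ μ G := by
  have h1 : 1 ≤ μ G + ENNReal.ofReal q := by
    rw [← measure_univ (μ := μ)]
    refine (measure_mono fun z _ => ?_).trans ((measure_union_le G A).trans (by gcongr))
    by_cases h : z ∈ A
    · exact Or.inr h
    · exact Or.inl (hG z h)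
  rw [ENNReal.ofReal_sub _ hq, ENNReal.ofReal_one]
  exact tsub_le_iff_right.2 h1

set_option maxHeartbeats 800000 in
theorem stmt8
    (n p : ℕ) (hn : 1 ≤ n) (hnp : n ≤ p) (hp2 : 2 ≤ p)
    (X : Matrix (Fin n) (Fin p) ℝ)
    (hX : ∀ j, Real.sqrt (∑ i, (X i j)^2) = Real.sqrt n)
    (σ : ℝ) (hσ : 0 < σ)
    (βs : Fin p → ℝ) (sstar : ℕ) (hs1 : 1 ≤ sstar)
    (Jstar : Finset (Fin p)) (hJstar : Jstar = Finset.univ.filter (fun j => βs j ≠ 0))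
    (hcard : Jstar.card = sstar)
    (P : Finset (Fin p) → (Fin n → ℝ) → (Fin n → ℝ))
    (hP : ∀ (J : Finset (Fin p)) (v : Fin n → ℝ),
        (∃ cf : Fin p → ℝ, (∀ j ∉ J, cf j = 0) ∧ P J v = X.mulVec cf)
        ∧ ∀ j ∈ J, (∑ i, (v i - P J v i) * X i j) = 0)
    (μ : Measure (Fin n → ℝ))
    (hμ : μ = Measure.pi (fun _ : Fin n => gaussianReal 0 (Real.toNNReal (σ^2))))
    (hminimal : ∀ b : Fin p → ℝ, X.mulVec b = X.mulVec βs →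
        sstar ≤ (Finset.univ.filter (fun j => b j ≠ 0)).card)
    (y : (Fin n → ℝ) → Fin n → ℝ)
    (hy : ∀ z i, y z i = X.mulVec βs i + z i)
    (sbar : ℕ) (hsbar1 : sstar ≤ sbar) (hsbar2 : sbar ≤ p)
    (lam : ℝ)
    (w Post : (Fin n → ℝ) → Finset (Fin p) → ℝ)
    (hw : ∀ z J, w z J = if J.card ≤ sbar then
        ((p.choose J.card : ℝ))⁻¹ * Real.exp (-(lam * (J.card : ℝ)))
          * Real.exp (-(∑ i, (y z i - P J (y z) i)^2) / (2 * σ^2)) else 0)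
    (hPost : ∀ z J, Post z J = w z J / ∑ J' : Finset (Fin p), w z J')
    (bh : (Fin n → ℝ) → Finset (Fin p) → Fin p → ℝ)
    (hbh : ∀ z J, (∀ j ∉ J, bh z J j = 0)
        ∧ X.mulVec (bh z J) = P J (y z)
        ∧ ∀ b : Fin p → ℝ, (∀ j ∉ J, b j = 0) → X.mulVec b = P J (y z) →
            ∑ j, (bh z J j)^2 ≤ ∑ j, (b j)^2)
    (nu : ℝ → ℝ)
    (hnu : ∀ s : ℝ, nu s = sInf {r : ℝ | ∃ (J : Finset (Fin p)) (u : Fin p → ℝ),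
        (J.card : ℝ) ≤ s ∧ (∀ j ∉ J, u j = 0) ∧ (∑ j, (u j)^2) = 1 ∧
        r = Real.sqrt (∑ i, (X.mulVec u i)^2) / Real.sqrt n})
    (nuJ : Finset (Fin p) → ℝ)
    (hnuJ : ∀ J : Finset (Fin p), nuJ J = sInf {r : ℝ | ∃ u : Fin p → ℝ,
        (∀ j ∉ J, u j = 0) ∧ (∑ j, (u j)^2) = 1 ∧
        r = Real.sqrt (∑ i, (X.mulVec u i)^2) / Real.sqrt n})
    (numin : ℝ)
    (hnumin : numin = sInf {r : ℝ | ∃ J : Finset (Fin p),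
        J.Nonempty ∧ 0 < nuJ J ∧ r = nuJ J})
    (ε c : ℝ) (hε : 0 < ε) (hc : 1 ≤ c)
    (hI : 0 < nu ((2 + ε) * (sstar : ℝ)))
    (hlam : lam = (((1 + ε) * (23 + 5 * c) + 1) / ε) * Real.log p)
    (hbmin : ∀ j ∈ Jstar,
        3 * σ * Real.sqrt (lam / n) / nu ((2 + ε) * (sstar : ℝ)) ≤ |βs j|)
    :
    ENNReal.ofReal (1 - 4 * (p : ℝ) ^ (-c)) ≤
      μ {z | ∀ j,
        |(∑ J ∈ Finset.univ.filter (fun J : Finset (Fin p) =>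
              LinearIndependent ℝ (fun jj : J => fun i : Fin n => X i (jj : Fin p))),
            Post z J * bh z J j) - βs j|
          ≤ σ * Real.sqrt (2 * (c + 1) * Real.log p
                / ((n : ℝ) * (nu (sstar : ℝ))^2))
            + (3 / (numin * (p : ℝ) ^ c)) *
              (σ * Real.sqrt ((20 + 4 * c) * Real.log p / (n : ℝ))
                + Real.sqrt (∑ i, (X.mulVec βs i)^2) / Real.sqrt n
                + numin * (⨆ j', |βs j'|))} := by
  set x : Fin p → EuclideanSpace ℝ (Fin n) := fun j => WithLp.toLp 2 fun i => X i j with hx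
  set f : EuclideanSpace ℝ (Fin n) := ∑ j, βs j • x j with hf
  set L : ℝ := Real.log p with hLdef
  have hp1 : (1 : ℝ) ≤ p := by exact_mod_cast (by omega : 1 ≤ p)
  have hp0 : (0 : ℝ) < p := by linarith
  have hn0 : (0 : ℝ) < n := by exact_mod_cast (by omega : 0 < n)
  have hL : 0 ≤ L := Real.log_nonneg hp1
  have hc0 : 0 ≤ c := by linarith
  have hβ0 : ∀ j ∉ Jstar, βs j = 0 := fun j hj => by
    by_contra h
    exact hj (by rw [hJstar]; simpa using h)
  have hJne : Jstar.Nonempty := card_pos.1 (by omega)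
  have hyf : ∀ z, (WithLp.toLp 2 (y z) : EuclideanSpace ℝ (Fin n)) = f + WithLp.toLp 2 z := by
    intro z
    have : y z = X.mulVec βs + z := funext fun i => hy z i
    rw [this, WithLp.toLp_add, toLp_mulVec_eq_sum_smul]
  have hPz : ∀ J v, (WithLp.toLp 2 (P J v) : EuclideanSpace ℝ (Fin n))
      = (columnSpan x J).starProjection (WithLp.toLp 2 v) := fun J v =>
    toLp_eq_starProjection_columnSpan X (hP J v).1 (hP J v).2
  have hnu_sq : ∀ (s : ℝ) (J : Finset (Fin p)) (u : Fin p → ℝ), (J.card : ℝ) ≤ s →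
      (∀ j ∉ J, u j = 0) → (Real.sqrt n * nu s) ^ 2 * ∑ j, u j ^ 2 ≤ ‖∑ j, u j • x j‖ ^ 2 := by
    intro s J u hJ hu
    rw [mul_pow, Real.sq_sqrt hn0.le, hnu s, ← sum_mulVec_sq_eq_norm_sq]
    refine mul_sInf_sq_mul_sum_sq_le X hn (by rintro _ ⟨_, _, _, _, _, rfl⟩; positivity) ?_
    exact fun t ht => ⟨J, _, hJ, fun j hj => by rw [hu j hj, mul_zero], ht, rfl⟩
  have hnu_pos : 0 < nu sstar := by
    refine hI.trans_le ?_
    rw [hnu, hnu]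
    refine csInf_le_csInf ⟨0, by rintro _ ⟨_, _, _, _, _, rfl⟩; positivity⟩ ?_ ?_
    · obtain ⟨j, hj⟩ := hJne
      refine ⟨_, {j}, Pi.single j 1, by simpa using hs1, fun k hk => ?_, ?_, rfl⟩
      · exact Pi.single_eq_of_ne (by simpa using hk) _
      · simp [Pi.single_apply]
    · rintro _ ⟨J, u, hJ, hu, hu1, rfl⟩
      refine ⟨J, u, hJ.trans ?_, hu, hu1, rfl⟩
      nlinarith [(Nat.cast_nonneg sstar : (0 : ℝ) ≤ sstar)]
  have hLI : ∀ J : Finset (Fin p),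
      LinearIndependent ℝ (fun jj : J => fun i : Fin n => X i (jj : Fin p)) ↔
        LinearIndependent ℝ fun j : J => x j := fun J =>
    ((WithLp.linearEquiv 2 ℝ (Fin n → ℝ)).symm.toLinearMap.linearIndependent_iff
      (LinearEquiv.ker _)).symm
  have hnuJ_pos : ∀ J : Finset (Fin p), J.Nonempty → (LinearIndependent ℝ fun j : J => x j) →
      0 < nuJ J := fun J hJ h => by
    rw [hnuJ]
    exact h.sInf_singular_value_pos hn hJ
  have hnumin_le : ∀ J : Finset (Fin p), J.Nonempty → (LinearIndependent ℝ fun j : J => x j) →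
      0 < numin ∧ numin ≤ nuJ J := fun J hJ h => by
    rw [hnumin]
    exact sInf_pos_and_le_of_finite_range hJ (hnuJ_pos J hJ h)
  have hJstarLI : LinearIndependent ℝ fun j : Jstar => x j :=
    linearIndependent_of_mul_sum_sq_le x (κ := (Real.sqrt n * nu sstar) ^ 2) (by positivity)
      fun u hu => hnu_sq sstar Jstar u (by rw [hcard]) hu
  have hnumin_pos : 0 < numin := (hnumin_le Jstar hJne hJstarLI).1
  have hbh_le : ∀ (z : Fin n → ℝ) (J : Finset (Fin p)) (j : Fin p),
      (LinearIndependent ℝ fun j : J => x j) →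
      Real.sqrt n * numin * |bh z J j|
        ≤ ‖(columnSpan x J).starProjection (f + WithLp.toLp 2 z)‖ := by
    intro z J j h
    rcases J.eq_empty_or_nonempty with rfl | hJ
    · rw [(hbh z ∅).1 j (notMem_empty j), abs_zero, mul_zero]
      exact norm_nonneg _
    have h1 : n * nuJ J ^ 2 * ∑ k, bh z J k ^ 2 ≤ ∑ i, X.mulVec (bh z J) i ^ 2 := by
      rw [hnuJ]
      refine mul_sInf_sq_mul_sum_sq_le X hn (by rintro _ ⟨_, _, _, rfl⟩; positivity) ?_
      exact fun t ht => ⟨_, fun k hk => by rw [(hbh z J).1 k hk, mul_zero], ht, rfl⟩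
    rw [(hbh z J).2.1] at h1
    rw [← hyf, ← hPz]
    have h2 : bh z J j ^ 2 ≤ ∑ k, bh z J k ^ 2 :=
      single_le_sum (fun k _ => sq_nonneg (bh z J k)) (mem_univ j)
    refine le_of_sq_le_sq ?_ (norm_nonneg _)
    rw [mul_pow, mul_pow, sq_abs, Real.sq_sqrt hn0.le, EuclideanSpace.real_norm_sq_eq]
    refine le_trans ?_ h1
    have h3 := (hnumin_le J hJ h).2
    gcongr
  set rJ : Finset (Fin p) → EuclideanSpace ℝ (Fin n) :=
    fun J => f - (columnSpan x J).starProjection f with hrJ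
  set rj : Fin p → EuclideanSpace ℝ (Fin n) :=
    fun j => x j - (columnSpan x (Jstar.erase j)).starProjection (x j) with hrj
  have hE1 := pi_gaussianReal_exists_index_inner_gt_le hp2 hσ hc0 rj
  have hE2 := pi_gaussianReal_exists_projection_gt_le hp2 hσ hc0 x ∅
  have hE3 := pi_gaussianReal_exists_projection_gt_le hp2 hσ hc0 x Jstar
  have hE4 := pi_gaussianReal_exists_inner_gt_le hp2 hσ hc0 rJ Jstar
  have hpc0 : 0 ≤ (p : ℝ) ^ (-c) := by positivity
  subst hμ
  refine ofReal_one_sub_le_measure _ (by positivity) ((measure_union_le _ _).trans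
    (((add_le_add ((measure_union_le _ _).trans (add_le_add hE1 hE2))
      ((measure_union_le _ _).trans (add_le_add hE3 hE4)))).trans_eq ?_)) ?_
  · rw [← ENNReal.ofReal_add (by positivity) (by positivity),
      ← ENNReal.ofReal_add (by positivity) (by positivity),
      ← ENNReal.ofReal_add (by positivity) (by positivity)]
    congr 1; ring
  intro z hz
  simp only [Set.mem_union, not_or, Set.mem_ofPred_eq, not_exists, not_and, not_lt, mem_univ,
    true_implies, mem_erase, ne_eq, and_true] at hz
  obtain ⟨⟨hz1, hz2⟩, hz3, hz4⟩ := hz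
  set ζ : EuclideanSpace ℝ (Fin n) := WithLp.toLp 2 z with hζ
  have hw_eq : ∀ J : Finset (Fin p), J.card ≤ sbar → w z J = ((p.choose J.card : ℕ) : ℝ)⁻¹
      * Real.exp (-(lam * J.card
        + ‖(f + ζ) - (columnSpan x J).starProjection (f + ζ)‖ ^ 2 / (2 * σ ^ 2))) := by
    intro J hJ
    rw [hw, if_pos hJ, mul_assoc, ← Real.exp_add, ← hyf, ← hPz, ← WithLp.toLp_sub,
      EuclideanSpace.real_norm_sq_eq]
    congr 2
    simp only [Pi.sub_apply]
    ring
  have hw_nonneg : ∀ J, 0 ≤ w z J := by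
    intro J
    rw [hw]
    split_ifs <;> positivity
  have hw_pos : 0 < w z Jstar := by
    rw [hw_eq Jstar (by omega)]
    have : 0 < p.choose Jstar.card := Nat.choose_pos (by simpa using card_le_univ Jstar)
    positivity
  have hratio : ∀ J ≠ Jstar, p * w z J
      ≤ Real.exp (-((4 + c) * L)) ^ (symmDiff J Jstar).card * w z Jstar := by
    intro J hJ
    rcases le_or_gt J.card sbar with hJs | hJs
    · rw [hw_eq J hJs, hw_eq Jstar (by omega)]
      refine mul_inv_choose_mul_exp_le hp2 hJ ?_
      refine penalized_residual_gap x (ν := Real.sqrt n * nu ((2 + ε) * sstar)) hσ hc hε hL hlam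
        (by positivity) (fun u hu hu0 => hnu_sq _ _ u (by rwa [hcard] at hu) hu0) hβ0
        (fun j hj => ?_) ?_ (hz4 J hJ)
      · refine le_of_eq_of_le ?_ (hbmin j hj)
        rw [Real.sqrt_div' _ hn0.le]
        field_simp
      · by_cases hD : J \ Jstar = ∅
        · simp [hD]
        · exact hz3 _ hD
    · rw [hw, if_neg (by omega), mul_zero]
      positivity
  have hZ : 0 < ∑ J', w z J' :=
    hw_pos.trans_le (single_le_sum (fun J _ => hw_nonneg J) (mem_univ Jstar))
  have hq := sum_erase_mul_div_sum_le hp2 hc0 (w z) Jstar hw_nonneg hw_pos hratio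
  simp only [← hPost] at hq
  have hPost1 : ∑ J, Post z J = 1 := by
    simp only [hPost]
    rw [← sum_div, div_self hZ.ne']
  have hfnorm : Real.sqrt (∑ i, (X.mulVec βs i) ^ 2) = ‖f‖ := by
    rw [sum_mulVec_sq_eq_norm_sq, Real.sqrt_sq (norm_nonneg _)]
  intro j
  have hT : |bh z Jstar j - βs j|
      ≤ σ * Real.sqrt (2 * (c + 1) * L / ((n : ℝ) * (nu (sstar : ℝ)) ^ 2)) := by
    by_cases hj : j ∈ Jstar
    · have h := mul_abs_coeff_le_of_abs_inner_le x (B := Jstar)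
        (h := fun j => bh z Jstar j - βs j) (z := ζ)
        (κ := Real.sqrt n * nu sstar) (by positivity)
        (fun u hu => hnu_sq sstar Jstar u (by rw [hcard]) hu)
        (fun k hk => by rw [(hbh z Jstar).1 k hk, hβ0 k hk, sub_zero]) ?_ hj (hz1 j)
      · rw [Real.sqrt_div' _ (by positivity), Real.sqrt_mul hn0.le, Real.sqrt_sq hnu_pos.le,
          ← mul_div_assoc, le_div_iff₀ (by positivity)]
        linarith
      · simp only [sub_smul, sum_sub_distrib]
        rw [← hf, hx, ← toLp_mulVec_eq_sum_smul, (hbh z Jstar).2.1, hPz, hyf, map_add,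
          Submodule.starProjection_eq_self_iff.2 (sum_smul_mem_columnSpan x hβ0),
          add_sub_cancel_left]
    · rw [(hbh z Jstar).1 j hj, hβ0 j hj, sub_zero, abs_zero]
      positivity
  have hM : ∀ J ∈ Finset.univ.filter (fun J : Finset (Fin p) =>
      LinearIndependent ℝ (fun jj : J => fun i : Fin n => X i (jj : Fin p))),
      |bh z J j| ≤ p * (numin⁻¹ * (σ * Real.sqrt ((20 + 4 * c) * L / n)
        + ‖f‖ / Real.sqrt n)) := by
    intro J hJ
    have hJ' := (hLI J).1 (mem_filter.1 hJ).2
    have h1 := hbh_le z J j hJ'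
    rw [map_add] at h1
    have h2 : ‖(columnSpan x J).starProjection f‖ ≤ p * ‖f‖ :=
      ((columnSpan x J).norm_starProjection_apply_le f).trans
        (le_mul_of_one_le_left (norm_nonneg _) hp1)
    have h3 : ‖(columnSpan x J).starProjection ζ‖ ≤ p * (σ * Real.sqrt ((20 + 4 * c) * L)) := by
      refine le_of_sq_le_sq ?_ (by positivity)
      rw [mul_pow, mul_pow, Real.sq_sqrt (by positivity)]
      have h4 : ‖(columnSpan x J).starProjection ζ‖ ^ 2 ≤ σ ^ 2 * ((20 + 4 * c) * J.card * L) := by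
        rcases J.eq_empty_or_nonempty with rfl | hJ0
        · simp [columnSpan_empty]
        · have := hz2 J hJ0.ne_empty
          simpa [columnSpan_empty] using this
      have h5 : (J.card : ℝ) ≤ p := by
        exact_mod_cast (by simpa using card_le_univ J : J.card ≤ p)
      have h6 : (J.card : ℝ) ≤ p ^ 2 := h5.trans (by nlinarith)
      calc _ ≤ σ ^ 2 * ((20 + 4 * c) * J.card * L) := h4
        _ ≤ σ ^ 2 * ((20 + 4 * c) * p ^ 2 * L) := by gcongr
        _ = _ := by ring
    have h4 := h1.trans ((norm_add_le _ _).trans (add_le_add h2 h3))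
    have hsn : 0 < Real.sqrt n := Real.sqrt_pos.2 hn0
    rw [Real.sqrt_div' _ hn0.le]
    refine le_of_mul_le_mul_left (h4.trans_eq ?_) (mul_pos hsn hnumin_pos)
    field_simp
    ring
  have hN : |βs j| ≤ ⨆ j', |βs j'| :=
    le_ciSup (f := fun j' => |βs j'|) (Set.finite_range _).bddAbove j
  refine (abs_sum_filter_mul_sub_le (by
      rw [mem_filter]
      exact ⟨mem_univ _, (hLI Jstar).2 hJstarLI⟩)
    (fun J => by rw [hPost]; exact div_nonneg (hw_nonneg J) hZ.le) hPost1 hp1 hq hT hM hN).trans ?_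
  rw [hfnorm]
  refine add_le_add_right ?_ _
  have hsup : 0 ≤ ⨆ j', |βs j'| := (abs_nonneg _).trans hN
  have hR : 0 ≤ σ * Real.sqrt ((20 + 4 * c) * L / n) + ‖f‖ / Real.sqrt n
      + numin * ⨆ j', |βs j'| := by positivity
  have heq : (p : ℝ) ^ (-c) * (numin⁻¹ * (σ * Real.sqrt ((20 + 4 * c) * L / n)
      + ‖f‖ / Real.sqrt n) + ⨆ j', |βs j'|)
      = 1 / (numin * (p : ℝ) ^ c) * (σ * Real.sqrt ((20 + 4 * c) * L / n)
        + ‖f‖ / Real.sqrt n + numin * ⨆ j', |βs j'|) := by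
    rw [Real.rpow_neg hp0.le]
    field_simp
  rw [heq]
  refine mul_le_mul_of_nonneg_right ?_ hR
  gcongr
  norm_num
end
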